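/- Cost Lemma: suppose n elements are inserted into a tree ensemble A, B_1, …, B_α whose trees have height H and whose common root label is an interval of length ℓ. For elements x, y occupying consecutive non-empty cells of the ensemble's array, call the cost |x − y| Type 1 if x and y lie in the same elementary tree (a node of A or one of the B_i), Type 2 if they lie in elementary trees representing two different nodes of A, and Type 3 if x lies in A and y lies in B_1, or x lies in B_i and y lies in B_{i+1} for some i ≥ 1. Then the total Type 1 cost is at most n·H·(ℓ/2^H), the total Type 2 cost is at most 9·n·H·(ℓ/2^H) + ℓ, and the total Type 3 cost is at most α·ℓ. -/

import Mathlib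

noncomputable section
attribute [local instance] Classical.propDecidable

/-- The state of an elementary tree: nodes are identified with paths from the root
(`false` = left, `true` = right); `label` records the interval `[lo, hi)` labeling a
marked node (`none` = unmarked), and `occ` records the element written in a leaf cell. -/
structure ETState where
  label : List Bool → Option (ℝ × ℝ)
  occ : List Bool → Option ℝ

/-- The initial state of an elementary tree whose root is statically labeled `I`. -/
def ETState.init (I : ℝ × ℝ) : ETState :=
  ⟨fun p => if p = [] then some I else none, fun _ => none⟩

/-- The half of the interval `I = [lo, hi)` containing `x`. -/
def halfContaining (I : ℝ × ℝ) (x : ℝ) : ℝ × ℝ :=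
  if x < (I.1 + I.2) / 2 then (I.1, (I.1 + I.2) / 2) else ((I.1 + I.2) / 2, I.2)

def ETState.setLabel (s : ETState) (p : List Bool) (I : ℝ × ℝ) : ETState :=
  ⟨fun q => if q = p then some I else s.label q, s.occ⟩

def ETState.setOcc (s : ETState) (p : List Bool) (x : ℝ) : ETState :=
  ⟨s.label, fun q => if q = p then some x else s.occ q⟩

/-- `etInsert d p pl x s` is the recursive procedure `insert(v, x)` at the node `v` with
path `p` and height `d` above the leaves (so leaves have `d = 0`), where `pl` is the label
of `v`'s parent.  It returns the success flag together with the updated state: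
* an unmarked leaf gets labeled with the half of `pl` containing `x`, and `x` is written
  into its cell (success); a marked leaf yields failure;
* a marked internal node: failure if `x` is inadmissible, otherwise insert into the left
  child and, if that fails, into the right child;
* an unmarked internal node gets labeled with the half of `pl` containing `x`, and the
  insertion proceeds into its left child. -/
def etInsert : ℕ → List Bool → (ℝ × ℝ) → ℝ → ETState → Bool × ETState
  | 0, p, pl, x, s =>
    match s.label p with
    | none => (true, (s.setLabel p (halfContaining pl x)).setOcc p x)
    | some _ => (false, s)
  | d + 1, p, pl, x, s =>
    match s.label p with
    | none =>
        let I := halfContaining pl x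
        etInsert d (p ++ [false]) I x (s.setLabel p I)
    | some I =>
        if I.1 ≤ x ∧ x < I.2 then
          match etInsert d (p ++ [false]) I x s with
          | (true, s') => (true, s')
          | (false, s') => etInsert d (p ++ [true]) I x s'
        else (false, s)

/-- Insert `x` at the root of an elementary tree of height `h` (the root is always
marked, so the parent label passed along is irrelevant). -/
def etInsertTop (h : ℕ) (x : ℝ) (s : ETState) : Bool × ETState :=
  etInsert h [] ((s.label []).getD (0, 1)) x s

/-- Insert the elements of `xs` one by one into an elementary tree of height `h` with
root label `I`, returning the conjunction of all success flags and the final state. -/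
def etRunAll (h : ℕ) (I : ℝ × ℝ) (xs : List ℝ) : Bool × ETState :=
  xs.foldl (fun acc x =>
    let r := etInsertTop h x acc.2
    (acc.1 && r.1, r.2)) (true, ETState.init I)

/-- The path (of length `h`) of the `i`-th leaf from the left in a tree of height `h`. -/
def pathOfIdx (h i : ℕ) : List Bool :=
  (List.range h).map fun k => Nat.testBit i (h - 1 - k)

/-- The static label of the composite-tree node at path `p` when the root is labeled `I`:
each step descends to the left or right half of the parent's interval. -/
def staticLabel : (ℝ × ℝ) → List Bool → ℝ × ℝ
  | I, [] => I
  | I, b :: p =>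
      staticLabel (if b then ((I.1 + I.2) / 2, I.2) else (I.1, (I.1 + I.2) / 2)) p

/-- The state of a composite tree: each node (a path of length `≤ H - 1` from the root)
carries an elementary tree. -/
def CTState : Type := List Bool → ETState

/-- The initial state of a composite tree with root label `I`: every node carries an empty
elementary tree whose root is statically labeled with the node's static label. -/
def ctInit (I : ℝ × ℝ) : CTState := fun p => ETState.init (staticLabel I p)

/-- The path of length `d` descending from an interval `I` always into the half
containing `x`; this is the path to the unique depth-`d` node whose static label
contains `x`. -/
def descend (x : ℝ) : (ℝ × ℝ) → ℕ → List Bool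
  | _, 0 => []
  | I, d + 1 =>
      if x < (I.1 + I.2) / 2 then false :: descend x (I.1, (I.1 + I.2) / 2) d
      else true :: descend x ((I.1 + I.2) / 2, I.2) d

/-- The sequence of composite-tree nodes tried when inserting `x` into a composite tree of
height `H` with root label `I`: the unique admissible leaf (height 1), then its parent
(height 2), and so on up to the root (height `H`); each entry is the node's path paired
with the height of its elementary tree. -/
def ctNodeSeq (H : ℕ) (I : ℝ × ℝ) (x : ℝ) : List (List Bool × ℕ) :=
  (List.range H).map fun i => ((descend x I (H - 1)).take (H - 1 - i), i + 1)

/-- Try to insert `x` into the elementary trees at the listed composite-tree nodes, in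
order, stopping at the first success. -/
def tryNodes (x : ℝ) : List (List Bool × ℕ) → CTState → Bool × CTState
  | [], f => (false, f)
  | (p, ht) :: rest, f =>
      match etInsertTop ht x (f p) with
      | (true, s') => (true, fun q => if q = p then s' else f q)
      | (false, s') => tryNodes x rest fun q => if q = p then s' else f q

/-- Insert `x` into a composite tree of height `H` with root label `I`: walk from the
unique admissible leaf up towards the root, inserting into the first elementary tree on
this path that accepts `x`. -/
def ctInsert (H : ℕ) (I : ℝ × ℝ) (x : ℝ) (f : CTState) : Bool × CTState :=
  tryNodes x (ctNodeSeq H I x) f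

/-- The state of a tree ensemble: one composite tree `A` followed by elementary trees
`B 0, B 1, …` (of which only the first `α` are used in an ensemble of order `α`). -/
structure EnsState where
  A : CTState
  B : ℕ → ETState

/-- The initial state of a tree ensemble with common root label `I`. -/
def ensInit (I : ℝ × ℝ) : EnsState := ⟨ctInit I, fun _ => ETState.init I⟩

/-- Try to insert `x` into the elementary trees `B j` for the listed indices `j`, in
order, stopping at the first success. -/
def tryBs (H : ℕ) (x : ℝ) : List ℕ → (ℕ → ETState) → Bool × (ℕ → ETState)
  | [], B => (false, B)
  | j :: rest, B =>
      match etInsertTop H x (B j) with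
      | (true, s') => (true, fun i => if i = j then s' else B i)
      | (false, s') => tryBs H x rest fun i => if i = j then s' else B i

/-- Insert `x` into a tree ensemble of order `α` (trees of height `H`, common root label
`I`): first try the composite tree `A`; if that fails, try `B 0, …, B (α-1)` in order. -/
def ensInsert (H α : ℕ) (I : ℝ × ℝ) (x : ℝ) (s : EnsState) : Bool × EnsState :=
  match ctInsert H I x s.A with
  | (true, A') => (true, ⟨A', s.B⟩)
  | (false, A') =>
      let r := tryBs H x (List.range α) s.B
      (r.1, ⟨A', r.2⟩)

/-- Insert the elements of `xs` one by one into a tree ensemble of order `α` with trees of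
height `H` and common root label `I`, returning the conjunction of all success flags
together with the final state. -/
def ensRun (H α : ℕ) (I : ℝ × ℝ) (xs : List ℝ) : Bool × EnsState :=
  xs.foldl (fun acc x =>
    let r := ensInsert H α I x acc.2
    (acc.1 && r.1, r.2)) (true, ensInit I)

/-- The cells of a composite tree of height `ht` rooted at the node with path `p`, in
array (in-order) order: the cells of the left child subtree, then the cells of the
elementary tree at the root, then the cells of the right child subtree.  Each cell is a
pair (composite node path, leaf path within that node's elementary tree). -/
def ctCellsAux : ℕ → List Bool → List (List Bool × List Bool)
  | 0, _ => []
  | ht + 1, p =>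
      ctCellsAux ht (p ++ [false]) ++
      ((List.range (2 ^ (ht + 1))).map fun i => (p, pathOfIdx (ht + 1) i)) ++
      ctCellsAux ht (p ++ [true])

/-- The cells of a tree ensemble of order `α` and height `H`, in array order: first the
composite tree `A` (stored in-order), then `B 0, …, B (α-1)`.  Each cell is tagged with
the elementary tree containing it (`Sum.inl p` = the elementary tree at composite node
`p`; `Sum.inr j` = the elementary tree `B j`) and carries its optional content. -/
def ensCells (H α : ℕ) (st : EnsState) : List ((List Bool ⊕ ℕ) × Option ℝ) :=
  ((ctCellsAux H []).map fun pq => (Sum.inl pq.1, (st.A pq.1).occ pq.2)) ++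
  (List.range α).flatMap fun j =>
    (List.range (2 ^ H)).map fun i => ((Sum.inr j : List Bool ⊕ ℕ), (st.B j).occ (pathOfIdx H i))

/-- The occupied cells of the ensemble, in array order, each with its tag. -/
def occSeq (H α : ℕ) (st : EnsState) : List ((List Bool ⊕ ℕ) × ℝ) :=
  (ensCells H α st).filterMap fun c => c.2.map fun x => (c.1, x)

/-- The pairs of elements occupying consecutive non-empty cells of the ensemble. -/
def consecPairs (H α : ℕ) (st : EnsState) :
    List (((List Bool ⊕ ℕ) × ℝ) × ((List Bool ⊕ ℕ) × ℝ)) :=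
  (occSeq H α st).zip (occSeq H α st).tail

/-- The total cost `|x - y|` over the consecutive pairs whose pair of tags satisfies
the predicate `P`. -/
def pairSum (P : (List Bool ⊕ ℕ) → (List Bool ⊕ ℕ) → Prop)
    (l : List (((List Bool ⊕ ℕ) × ℝ) × ((List Bool ⊕ ℕ) × ℝ))) : ℝ :=
  (l.map fun ab => if P ab.1.1 ab.2.1 then |ab.1.2 - ab.2.2| else 0).sum

/-! ### Dyadic words -/

theorem sl_append (I : ℝ × ℝ) (w : List Bool) (b : Bool) :
    staticLabel I (w ++ [b]) =
      if b then (((staticLabel I w).1 + (staticLabel I w).2) / 2, (staticLabel I w).2)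
      else ((staticLabel I w).1, ((staticLabel I w).1 + (staticLabel I w).2) / 2) := by
  induction w generalizing I with
  | nil => simp [staticLabel]
  | cons c w ih => simp only [List.cons_append, staticLabel, ih]

theorem sl_len (I : ℝ × ℝ) (w : List Bool) :
    (staticLabel I w).2 - (staticLabel I w).1 = (I.2 - I.1) / 2 ^ w.length := by
  induction w generalizing I with
  | nil => simp [staticLabel]
  | cons c w ih =>
    simp only [staticLabel, ih, List.length_cons]
    cases c <;> simp <;> field_simp <;> ring

theorem descend_length (x : ℝ) (I : ℝ × ℝ) (d : ℕ) : (descend x I d).length = d := by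
  induction d generalizing I with
  | zero => rfl
  | succ d ih => simp only [descend]; split_ifs <;> simp [ih]

theorem descend_take (x : ℝ) (I : ℝ × ℝ) (d k : ℕ) (h : k ≤ d) :
    (descend x I d).take k = descend x I k := by
  induction k generalizing I d with
  | zero => simp [descend]
  | succ k ih =>
    obtain ⟨d, rfl⟩ : ∃ e, d = e + 1 := ⟨d - 1, by omega⟩
    simp only [descend]; split_ifs <;> simp [ih _ d (by omega)]

theorem mem_sl_of_prefix (x : ℝ) (I : ℝ × ℝ) (hx : I.1 ≤ x ∧ x < I.2) (d : ℕ) (w : List Bool)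
    (h : w <+: descend x I d) : (staticLabel I w).1 ≤ x ∧ x < (staticLabel I w).2 := by
  induction w generalizing I d with
  | nil => simpa [staticLabel] using hx
  | cons b w ih =>
    cases d with
    | zero => simp [descend] at h
    | succ d =>
      simp only [descend] at h
      split_ifs at h with hc
      · rw [List.cons_prefix_cons] at h
        obtain ⟨rfl, h⟩ := h
        simp only [staticLabel]
        exact ih _ ⟨hx.1, hc⟩ d h
      · rw [List.cons_prefix_cons] at h
        obtain ⟨rfl, h⟩ := h
        simp only [staticLabel]
        exact ih _ ⟨not_lt.1 hc, hx.2⟩ d h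

theorem sl_sub (I : ℝ × ℝ) (hI : I.1 ≤ I.2) (w : List Bool) :
    I.1 ≤ (staticLabel I w).1 ∧ (staticLabel I w).2 ≤ I.2 := by
  induction w generalizing I with
  | nil => simp [staticLabel]
  | cons b w ih =>
    simp only [staticLabel]
    cases b
    · have := ih (I.1, (I.1 + I.2) / 2) (by simp; linarith)
      simp at this ⊢; constructor <;> linarith
    · have := ih ((I.1 + I.2) / 2, I.2) (by simp; linarith)
      simp at this ⊢; constructor <;> linarith

theorem prefix_of_mem_sl (x : ℝ) (I : ℝ × ℝ) (hI : I.1 ≤ I.2) (d : ℕ) (w : List Bool)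
    (hw : w.length ≤ d)
    (h : (staticLabel I w).1 ≤ x ∧ x < (staticLabel I w).2) : w <+: descend x I d := by
  induction w generalizing I d with
  | nil => simp
  | cons b w ih =>
    cases d with
    | zero => simp at hw
    | succ d =>
      simp only [List.length_cons, Nat.add_le_add_iff_right] at hw
      simp only [staticLabel] at h
      simp only [descend]
      cases b
      · have h1 := sl_sub (I.1, (I.1 + I.2) / 2) (by simp; linarith) w
        have h2 := ih (I.1, (I.1 + I.2) / 2) (by simp; linarith) d hw (by simpa using h)
        simp at h h1
        rw [if_pos (by linarith)]
        simpa using h2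
      · have h1 := sl_sub ((I.1 + I.2) / 2, I.2) (by simp; linarith) w
        have h2 := ih ((I.1 + I.2) / 2, I.2) (by simp; linarith) d hw (by simpa using h)
        simp at h h1
        rw [if_neg (by linarith)]
        simpa using h2

theorem half_sl (x : ℝ) (I : ℝ × ℝ) (d : ℕ) :
    halfContaining (staticLabel I (descend x I d)) x = staticLabel I (descend x I (d + 1)) := by
  induction d generalizing I with
  | zero =>
    simp only [descend, staticLabel, halfContaining]
    split_ifs <;> simp [staticLabel]
  | succ d ih =>
    rw [descend]
    conv_rhs => rw [descend]
    split_ifs with hc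
    · simp only [staticLabel]; exact ih _
    · simp only [staticLabel]; exact ih _

/-! ### Abstract elementary trees -/

inductive ETree where
  | emp : ETree
  | leaf : ℝ → ETree
  | nd : List Bool → ETree → ETree → ETree

namespace ETree

def elems : ETree → List ℝ
  | emp => []
  | leaf x => [x]
  | nd _ l r => elems l ++ elems r

def opens : ETree → List (List Bool)
  | emp => []
  | leaf _ => []
  | nd w l r => opens l ++ opens r ++ (if r = emp then [w] else [])

def closed : ETree → List (List Bool)
  | emp => []
  | leaf _ => []
  | nd w l r => closed l ++ closed r ++ (if r = emp then [] else [w])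

def Wf (H : ℕ) (I : ℝ × ℝ) : ℕ → List Bool → ETree → Prop
  | _, _, emp => True
  | d, u, leaf x => d = 0 ∧ u <+: descend x I H ∧ I.1 ≤ x ∧ x < I.2
  | d, u, nd w l r => u <+: w ∧ w.length + d = H ∧ 0 < d ∧ Wf H I (d - 1) w l ∧ Wf H I (d - 1) w r ∧
      (l = emp → r = emp)

def fresh (H : ℕ) (x : ℝ) (xw : List Bool) : ℕ → ETree
  | 0 => leaf x
  | d + 1 => nd (xw.take (H - (d + 1))) (fresh H x xw d) emp

def ins (H : ℕ) (x : ℝ) (xw : List Bool) : ℕ → ETree → Option ETree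
  | d, emp => some (fresh H x xw d)
  | _, leaf _ => none
  | d, nd w l r =>
      if w <+: xw then
        match ins H x xw (d - 1) l with
        | some l' => some (nd w l' r)
        | none => (ins H x xw (d - 1) r).map (nd w l)
      else none

theorem fresh_ne (H : ℕ) (x : ℝ) (xw : List Bool) (d : ℕ) : fresh H x xw d ≠ emp := by
  cases d <;> simp [fresh]

theorem fresh_wf (H : ℕ) (I : ℝ × ℝ) (x : ℝ) (hx : I.1 ≤ x ∧ x < I.2) (d : ℕ) (hd : d ≤ H)
    (u : List Bool) (hu : u <+: descend x I H) (hl : u.length + d ≤ H) :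
    Wf H I d u (fresh H x (descend x I H) d) := by
  induction d generalizing u with
  | zero => exact ⟨rfl, hu, hx⟩
  | succ d ih =>
    have hlen := descend_length x I H
    refine ⟨?_, ?_, by omega, ?_, trivial, fun h => rfl⟩
    · rw [List.prefix_take_iff]; exact ⟨hu, by omega⟩
    · simp [hlen]; omega
    · refine ih (by omega) _ (List.take_prefix _ _) ?_
      simp [hlen]; omega

theorem fresh_elems (H : ℕ) (x : ℝ) (xw : List Bool) (d : ℕ) :
    (fresh H x xw d).elems = [x] := by
  induction d with
  | zero => rfl
  | succ d ih => simp [fresh, elems, ih]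

theorem fresh_opens (H : ℕ) (x : ℝ) (xw : List Bool) (hl : xw.length = H) (d : ℕ) (hd : d ≤ H) :
    (∀ c ∈ (fresh H x xw d).opens, c <+: xw ∧ H ≤ c.length + d) ∧
    (fresh H x xw d).opens.Pairwise (fun a b => ¬ a <+: b) := by
  induction d with
  | zero => simp [fresh, opens]
  | succ d ih =>
    obtain ⟨h1, h2⟩ := ih (by omega)
    have hlen : (xw.take (H - (d + 1))).length = H - (d + 1) := by simp [hl]
    simp only [fresh, opens, List.append_nil, if_true]
    constructor
    · intro c hc
      rw [List.mem_append] at hc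
      rcases hc with hc | hc
      · have := h1 c hc; exact ⟨this.1, by omega⟩
      · rw [List.mem_singleton] at hc; subst hc
        exact ⟨List.take_prefix _ _, by omega⟩
    · rw [List.pairwise_append]
      refine ⟨h2, by simp, ?_⟩
      intro a ha b hb hab
      rw [List.mem_singleton] at hb; subst hb
      have := (h1 a ha).2
      have := hab.length_le
      omega

theorem Wf.opens_ext {H : ℕ} {I : ℝ × ℝ} {d : ℕ} {u : List Bool} {T : ETree} (h : Wf H I d u T) :
    ∀ a ∈ T.opens, u <+: a := by
  induction T generalizing d u with
  | emp => simp [opens]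
  | leaf x => simp [opens]
  | nd w l r ihl ihr =>
    obtain ⟨h1, h2, h3, h4, h5, h6⟩ := h
    intro a ha
    simp only [opens, List.mem_append] at ha
    rcases ha with (ha | ha) | ha
    · exact h1.trans (ihl h4 a ha)
    · exact h1.trans (ihr h5 a ha)
    · split_ifs at ha
      · simp at ha; subst ha; exact h1
      · simp at ha

theorem Wf.elems_ext {H : ℕ} {I : ℝ × ℝ} {d : ℕ} {u : List Bool} {T : ETree} (h : Wf H I d u T) :
    ∀ x ∈ T.elems, u <+: descend x I H ∧ I.1 ≤ x ∧ x < I.2 := by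
  induction T generalizing d u with
  | emp => simp [elems]
  | leaf y => simpa [elems] using h.2
  | nd w l r ihl ihr =>
    obtain ⟨h1, h2, h3, h4, h5, h6⟩ := h
    intro a ha
    simp only [elems, List.mem_append] at ha
    rcases ha with ha | ha
    · exact ⟨h1.trans (ihl h4 a ha).1, (ihl h4 a ha).2⟩
    · exact ⟨h1.trans (ihr h5 a ha).1, (ihr h5 a ha).2⟩

theorem ins_none {H : ℕ} {I : ℝ × ℝ} {x : ℝ} {xw : List Bool} {d : ℕ} {u : List Bool} {T : ETree}
    (h : Wf H I d u T) (hn : ins H x xw d T = none) : ∀ a ∈ T.opens, ¬ a <+: xw := by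
  induction T generalizing d u with
  | emp => simp [opens]
  | leaf y => simp [opens]
  | nd w l r ihl ihr =>
    by_cases hw : w <+: xw
    · obtain ⟨h1, h2, h3, h4, h5, h6⟩ := h
      rw [ins, if_pos hw] at hn
      cases hl : ins H x xw (d - 1) l with
      | some l' => rw [hl] at hn; simp at hn
      | none =>
        rw [hl] at hn
        simp only [Option.map_eq_none_iff] at hn
        have hr : r ≠ emp := by rintro rfl; simp [ins] at hn
        intro a ha
        simp only [opens, List.mem_append, if_neg hr, List.not_mem_nil, or_false] at ha
        rcases ha with ha | ha
        · exact ihl h4 hl a ha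
        · exact ihr h5 hn a ha
    · intro a ha hax
      have : Wf H I d w (nd w l r) := ⟨List.prefix_rfl, h.2⟩
      exact hw ((this.opens_ext a ha).trans hax)

theorem ins_ne {H : ℕ} {x : ℝ} {xw : List Bool} {d : ℕ} {T T' : ETree}
    (h : ins H x xw d T = some T') : T' ≠ emp := by
  cases T with
  | emp => simp only [ins, Option.some.injEq] at h; subst h; exact fresh_ne _ _ _ _
  | leaf y => simp [ins] at h
  | nd w l r =>
    simp only [ins] at h
    split_ifs at h
    rcases hl : ins H x xw (d - 1) l with _ | l'
    · rw [hl] at h; simp only [Option.map_eq_some_iff] at h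
      obtain ⟨a, _, rfl⟩ := h; simp
    · rw [hl] at h; simp at h; subst h; simp

theorem ins_nd {H : ℕ} {x : ℝ} {xw : List Bool} {d : ℕ} {w : List Bool} {l r T' : ETree}
    (h : ins H x xw d (nd w l r) = some T') : w <+: xw ∧
      ((∃ l', ins H x xw (d - 1) l = some l' ∧ T' = nd w l' r) ∨
       (ins H x xw (d - 1) l = none ∧ ∃ r', ins H x xw (d - 1) r = some r' ∧ T' = nd w l r')) := by
  simp only [ins] at h
  split_ifs at h with hw
  refine ⟨hw, ?_⟩
  rcases hl : ins H x xw (d - 1) l with _ | l'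
  · rw [hl] at h; simp only [Option.map_eq_some_iff] at h
    obtain ⟨a, h1, rfl⟩ := h
    exact Or.inr ⟨rfl, a, h1, rfl⟩
  · rw [hl] at h; simp at h; exact Or.inl ⟨l', rfl, h.symm⟩

theorem ins_wf {H : ℕ} {I : ℝ × ℝ} {x : ℝ} (hx : I.1 ≤ x ∧ x < I.2) {d : ℕ} {u : List Bool}
    {T T' : ETree} (h : Wf H I d u T) (hu : u <+: descend x I H) (hl : u.length + d ≤ H)
    (hs : ins H x (descend x I H) d T = some T') :
    Wf H I d u T' ∧ T'.elems.length = T.elems.length + 1 := by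
  induction T generalizing d u T' with
  | emp =>
    simp only [ins, Option.some.injEq] at hs; subst hs
    exact ⟨fresh_wf H I x hx d (by omega) u hu hl, by simp [fresh_elems, elems]⟩
  | leaf y => simp [ins] at hs
  | nd w l r ihl ihr =>
    obtain ⟨h1, h2, h3, h4, h5, h6⟩ := h
    obtain ⟨hw, ⟨l', hl', rfl⟩ | ⟨hl0, r', hr', rfl⟩⟩ := ins_nd hs
    · obtain ⟨k1, k2⟩ := ihl h4 hw (by omega) hl'
      refine ⟨⟨h1, h2, h3, k1, h5, fun e => absurd e (ins_ne hl')⟩, ?_⟩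
      simp [elems, k2]; omega
    · obtain ⟨k1, k2⟩ := ihr h5 hw (by omega) hr'
      refine ⟨⟨h1, h2, h3, h4, k1, ?_⟩, ?_⟩
      · rintro rfl; simp [ins] at hl0
      · simp [elems, k2]; omega

theorem ins_opens {H : ℕ} {I : ℝ × ℝ} {x : ℝ} {xw : List Bool} (hxw : xw.length = H) {d : ℕ}
    {u : List Bool} {T T' : ETree} (h : Wf H I d u T) (hT : T ≠ emp)
    (hs : ins H x xw d T = some T') :
    ∃ L1 v L2 C, T.opens = L1 ++ v :: L2 ∧ T'.opens = L1 ++ C ++ L2 ∧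
      (∀ a ∈ L1, ¬ a <+: xw) ∧ v <+: xw ∧ (∀ c ∈ C, c <+: xw ∧ v <+: c) ∧
      C.Pairwise (fun a b => ¬ a <+: b) := by
  induction T generalizing d u T' with
  | emp => exact absurd rfl hT
  | leaf y => simp [ins] at hs
  | nd w l r ihl ihr =>
    obtain ⟨h1, h2, h3, h4, h5, h6⟩ := h
    obtain ⟨f1, f2⟩ := fresh_opens H x xw hxw (d - 1) (by omega)
    have f3 : w <+: xw → ∀ c ∈ (fresh H x xw (d - 1)).opens, w <+: c := fun hw c hc =>
      List.prefix_of_prefix_length_le hw (f1 c hc).1 (by have := (f1 c hc).2; omega)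
    obtain ⟨hw, ⟨l', hl', rfl⟩ | ⟨hl0, r', hr', rfl⟩⟩ := ins_nd hs
    · by_cases hl : l = emp
      · have hr := h6 hl
        subst hl hr
        simp only [ins, Option.some.injEq] at hl'; subst hl'
        refine ⟨[], w, [], (fresh H x xw (d - 1)).opens ++ [w], by simp [opens], by simp [opens],
          by simp, hw, ?_, ?_⟩
        · intro c hc
          rw [List.mem_append, List.mem_singleton] at hc
          rcases hc with hc | rfl
          · exact ⟨(f1 c hc).1, f3 hw c hc⟩
          · exact ⟨hw, List.prefix_rfl⟩
        · rw [List.pairwise_append]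
          refine ⟨f2, by simp, ?_⟩
          intro a ha b hb hab
          rw [List.mem_singleton] at hb; subst hb
          have := (f1 a ha).2
          have := hab.length_le
          omega
      · obtain ⟨L1, v, L2, C, e1, e2, e3⟩ := ihl h4 hl hl'
        exact ⟨L1, v, L2 ++ r.opens ++ (if r = emp then [w] else []), C, by simp [opens, e1],
          by simp [opens, e2], e3⟩
    · have hf := ins_none h4 hl0
      have hr'e := ins_ne hr'
      by_cases hr : r = emp
      · subst hr
        simp only [ins, Option.some.injEq] at hr'; subst hr'
        exact ⟨l.opens, w, [], (fresh H x xw (d - 1)).opens, by simp [opens],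
          by simp [opens, fresh_ne], hf, hw, fun c hc => ⟨(f1 c hc).1, f3 hw c hc⟩, f2⟩
      · obtain ⟨L1, v, L2, C, e1, e2, e3, e4⟩ := ihr h5 hr hr'
        refine ⟨l.opens ++ L1, v, L2, C, by simp [opens, e1, hr],
          by simp [opens, e2, hr'e], ?_, e4⟩
        intro a ha
        rw [List.mem_append] at ha
        exact ha.elim (hf a) (e3 a)

end ETree
namespace ETree

def lev (H : ℕ) : ETree → List ℕ
  | emp => []
  | leaf _ => [H]
  | nd w l r => w.length :: (lev H l ++ lev H r)

def cl (m : ℕ) (T : ETree) : ℕ := T.closed.countP (fun w => w.length = m)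

def op (m : ℕ) (T : ETree) : ℕ := T.opens.countP (fun w => w.length = m)

theorem lev_eq {H : ℕ} {m : ℕ} (hm : m < H) (T : ETree) :
    (lev H T).count m = op m T + cl m T := by
  induction T with
  | emp => simp [lev, op, cl, opens, closed]
  | leaf x =>
    simp only [lev, op, cl, opens, closed, List.count_cons, List.count_nil, List.countP_nil]
    rw [if_neg (by simp; omega)]
  | nd w l r ihl ihr =>
    simp only [op, cl] at ihl ihr
    simp only [lev, op, cl, opens, closed, List.count_cons, List.count_append, List.countP_append,
      ihl, ihr]
    split_ifs <;> simp_all <;> omega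

theorem lev_ge {H : ℕ} {I : ℝ × ℝ} {m : ℕ} {d : ℕ} {u : List Bool}
    {T : ETree} (h : Wf H I d u T) :
    (if T ≠ emp ∧ m + 1 + d = H then 1 else 0) + 2 * cl m T ≤ (lev H T).count (m + 1) := by
  induction T generalizing d u with
  | emp => simp [lev, cl, closed]
  | leaf x =>
    obtain ⟨rfl, _⟩ := h
    simp only [lev, cl, closed, List.count_cons]
    split_ifs <;> simp_all
  | nd w l r ihl ihr =>
    obtain ⟨h1, h2, h3, h4, h5, h6⟩ := h
    have il := ihl h4
    have ir := ihr h5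
    simp only [cl] at il ir
    simp only [lev, cl, closed, List.count_cons, List.count_append, List.countP_append]
    by_cases hr : r = emp
    · subst hr
      by_cases hl : l = emp
      · subst hl
        simp [closed] 
        split_ifs <;> omega
      · simp [closed, hl] at il ⊢
        split_ifs at il ⊢ <;> omega
    · have hl : l ≠ emp := fun e => hr (h6 e)
      simp only [ne_eq, hl, hr, not_false_eq_true, true_and] at il ir
      simp only [if_neg hr, List.countP_cons, List.countP_nil]
      simp
      split_ifs at il ir ⊢ <;> omega

theorem lev_top {H : ℕ} {I : ℝ × ℝ} {d : ℕ} {u : List Bool}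
    {T : ETree} (h : Wf H I d u T) : (lev H T).count H = T.elems.length := by
  induction T generalizing d u with
  | emp => simp [lev, elems]
  | leaf x => simp [lev, elems]
  | nd w l r ihl ihr =>
    obtain ⟨h1, h2, h3, h4, h5, h6⟩ := h
    simp only [lev, elems, List.count_cons, List.count_append, ihl h4, ihr h5, List.length_append]
    simp; omega

theorem lev_root {H : ℕ} {I : ℝ × ℝ} {d : ℕ} {u w : List Bool} {l r : ETree}
    (h : Wf H I d u (nd w l r)) (he : (nd w l r).elems ≠ []) :
    1 ≤ (lev H (nd w l r)).count (w.length + 1) := by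
  obtain ⟨h1, h2, h3, h4, h5, h6⟩ := h
  have hl : l ≠ emp := by
    rintro rfl
    rw [h6 rfl] at he; simp [elems] at he
  have := lev_ge (m := w.length) h4
  rw [if_pos ⟨hl, by omega⟩] at this
  simp only [lev, List.count_cons, List.count_append]
  omega

end ETree

/-! ### Consecutive sums -/

def cs {β : Type} (f : β → β → ℝ) : List β → ℝ
  | [] => 0
  | [_] => 0
  | a :: b :: l => f a b + cs f (b :: l)

def br {β : Type} (f : β → β → ℝ) : Option β → Option β → ℝ
  | some a, some b => f a b
  | _, _ => 0

theorem cs_eq {β : Type} (f : β → β → ℝ) (l : List β) :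
    cs f l = ((l.zip l.tail).map fun ab => f ab.1 ab.2).sum := by
  induction l with
  | nil => simp [cs]
  | cons a l ih =>
    cases l with
    | nil => simp [cs]
    | cons b l => simp [cs, ih]

theorem cs_append {β : Type} (f : β → β → ℝ) (l₁ l₂ : List β) :
    cs f (l₁ ++ l₂) = cs f l₁ + cs f l₂ + br f l₁.getLast? l₂.head? := by
  induction l₁ with
  | nil => simp [cs, br]
  | cons a l ih =>
    cases l with
    | nil =>
      cases l₂ with
      | nil => simp [cs, br]
      | cons c l₂ => simp [cs, br]; ring
    | cons b l =>
      simp only [List.cons_append] at ih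
      simp only [List.cons_append, cs, ih, List.getLast?_cons_cons]
      ring

theorem cs_map {β γ : Type} (f : β → β → ℝ) (g : γ → β) (l : List γ) :
    cs f (l.map g) = cs (fun a b => f (g a) (g b)) l := by
  induction l with
  | nil => simp [cs]
  | cons a l ih =>
    cases l with
    | nil => simp [cs]
    | cons b l => simp only [List.map_cons, cs] at ih ⊢; rw [ih]

theorem cs_nonpos {β : Type} (f : β → β → ℝ) (l : List β)
    (h : ∀ a ∈ l, ∀ b ∈ l, f a b ≤ 0) : cs f l ≤ 0 := by
  induction l with
  | nil => simp [cs]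
  | cons a l ih =>
    cases l with
    | nil => simp [cs]
    | cons b l =>
      have h1 := ih (fun a ha b hb => h a (List.mem_cons_of_mem _ ha) b (List.mem_cons_of_mem _ hb))
      have h2 := h a (by simp) b (by simp)
      simp only [cs]; linarith

theorem cs_add {β : Type} (f g : β → β → ℝ) (l : List β) :
    cs (fun a b => f a b + g a b) l = cs f l + cs g l := by
  induction l with
  | nil => simp [cs]
  | cons a l ih =>
    cases l with
    | nil => simp [cs]
    | cons b l => simp only [cs, ih]; ring

theorem cs_congr {β : Type} (f g : β → β → ℝ) (l : List β)
    (h : ∀ a ∈ l, ∀ b ∈ l, f a b = g a b) : cs f l = cs g l := by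
  induction l with
  | nil => simp [cs]
  | cons a l ih =>
    cases l with
    | nil => simp [cs]
    | cons b l =>
      have h1 := ih (fun a ha b hb => h a (List.mem_cons_of_mem _ ha) b (List.mem_cons_of_mem _ hb))
      have h2 := h a (by simp) b (by simp)
      simp only [cs]; rw [h1, h2]

theorem br_le {β : Type} (f : β → β → ℝ) (l₁ l₂ : List β) (C : ℝ) (hC : 0 ≤ C)
    (h : ∀ a ∈ l₁, ∀ b ∈ l₂, f a b ≤ C) : br f l₁.getLast? l₂.head? ≤ C := by
  cases h1 : l₁.getLast? with
  | none => simpa [br] using hC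
  | some a =>
    cases h2 : l₂.head? with
    | none => simpa [br] using hC
    | some b => exact h a (List.mem_of_getLast? h1) b (List.mem_of_mem_head? h2)

theorem cs_tele {β : Type} (g : β → ℝ) (l : List β) (C : ℝ) (hC : 0 ≤ C)
    (h : ∀ a ∈ l, ∀ b ∈ l, g b - g a ≤ C) : cs (fun a b => g b - g a) l ≤ C := by
  have key : ∀ (l : List β) (a : β), ∃ b ∈ a :: l, cs (fun a b => g b - g a) (a :: l) = g b - g a := by
    intro l
    induction l with
    | nil => intro a; exact ⟨a, by simp, by simp [cs]⟩
    | cons c l ih =>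
      intro a
      obtain ⟨b, hb, e⟩ := ih c
      exact ⟨b, List.mem_cons_of_mem _ hb, by simp only [cs, e]; ring⟩
  cases l with
  | nil => simpa [cs] using hC
  | cons a l =>
    obtain ⟨b, hb, e⟩ := key l a
    rw [e]; exact h a (by simp) b hb

theorem dist_le (H : ℕ) (I : ℝ × ℝ) (w : List Bool) (x y : ℝ)
    (hx : w <+: descend x I H ∧ I.1 ≤ x ∧ x < I.2) (hy : w <+: descend y I H ∧ I.1 ≤ y ∧ y < I.2) :
    |x - y| ≤ (I.2 - I.1) / 2 ^ w.length := by
  have h1 := mem_sl_of_prefix x I hx.2 H w hx.1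
  have h2 := mem_sl_of_prefix y I hy.2 H w hy.1
  have h3 := sl_len I w
  rw [abs_le]; constructor <;> linarith

theorem ETree.cost_le {H : ℕ} {I : ℝ × ℝ} (hI : I.1 ≤ I.2) {d : ℕ} {u : List Bool}
    {T : ETree} (h : Wf H I d u T) :
    cs (fun x y => |x - y|) T.elems ≤
      (T.closed.map fun w => (I.2 - I.1) / 2 ^ w.length).sum := by
  induction T generalizing d u with
  | emp => simp [elems, closed, cs]
  | leaf x => simp [elems, closed, cs]
  | nd w l r ihl ihr =>
    obtain ⟨h1, h2, h3, h4, h5, h6⟩ := h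
    simp only [elems, closed, cs_append, List.map_append, List.sum_append]
    have il := ihl h4
    have ir := ihr h5
    by_cases hr : r = emp
    · subst hr
      simp [elems, closed, cs, br] at il ir ⊢
      exact il
    · have := br_le (fun x y : ℝ => |x - y|) l.elems r.elems ((I.2 - I.1) / 2 ^ w.length)
        (div_nonneg (by linarith) (by positivity)) (fun a ha b hb =>
          dist_le H I w a b (h4.elems_ext a ha) (h5.elems_ext b hb))
      simp [hr]
      linarith

/-! ### Representation -/

def TRep (I : ℝ × ℝ) (s : ETState) : ℕ → List Bool → ETree → Prop
  | _, p, .emp => ∀ q, p <+: q → s.label q = none ∧ s.occ q = none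
  | d, p, .leaf x => d = 0 ∧ s.label p ≠ none ∧ s.occ p = some x
  | d, p, .nd w l r => 0 < d ∧ s.label p = some (staticLabel I w) ∧
      TRep I s (d - 1) (p ++ [false]) l ∧ TRep I s (d - 1) (p ++ [true]) r

theorem TRep.congr {I : ℝ × ℝ} {s s' : ETState} {d : ℕ} {p : List Bool} {T : ETree}
    (h : TRep I s d p T) (hq : ∀ q, p <+: q → s'.label q = s.label q ∧ s'.occ q = s.occ q) :
    TRep I s' d p T := by
  induction T generalizing d p with
  | emp => intro q hp; rw [(hq q hp).1, (hq q hp).2]; exact h q hp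
  | leaf x =>
    obtain ⟨h1, h2, h3⟩ := h
    refine ⟨h1, ?_, ?_⟩
    · rw [(hq p List.prefix_rfl).1]; exact h2
    · rw [(hq p List.prefix_rfl).2]; exact h3
  | nd w l r ihl ihr =>
    obtain ⟨h1, h2, h3, h4⟩ := h
    refine ⟨h1, ?_, ihl h3 fun q hp => hq q ((List.prefix_append _ _).trans hp),
      ihr h4 fun q hp => hq q ((List.prefix_append _ _).trans hp)⟩
    rw [(hq p List.prefix_rfl).1]; exact h2

theorem not_pre_lr {p q : List Bool} {b : Bool} (h : (p ++ [b]) <+: q) : ¬ (p ++ [!b]) <+: q := by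
  intro h'
  have := List.prefix_of_prefix_length_le h h' (by simp)
  have := this.eq_of_length (by simp)
  simp at this

theorem etInsert_fresh (H : ℕ) (I : ℝ × ℝ) (x : ℝ) (d : ℕ) (p : List Bool) (s : ETState)
    (hd : d + 1 ≤ H) (hs : ∀ q, p <+: q → s.label q = none ∧ s.occ q = none) :
    ∃ s', etInsert d p (staticLabel I (descend x I (H - (d + 1)))) x s = (true, s') ∧
      TRep I s' d p (ETree.fresh H x (descend x I H) d) ∧
      ∀ q, ¬ p <+: q → s'.label q = s.label q ∧ s'.occ q = s.occ q := by
  induction d generalizing p s with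
  | zero =>
    refine ⟨_, by rw [etInsert, (hs p List.prefix_rfl).1], ⟨rfl, ?_, ?_⟩, ?_⟩
    · simp [ETState.setLabel, ETState.setOcc]
    · simp [ETState.setLabel, ETState.setOcc]
    · intro q hq
      have : q ≠ p := by rintro rfl; exact hq List.prefix_rfl
      simp [ETState.setLabel, ETState.setOcc, this]
  | succ d ih =>
    have e : halfContaining (staticLabel I (descend x I (H - (d + 1 + 1)))) x =
        staticLabel I (descend x I (H - (d + 1))) := by
      rw [half_sl]; congr 2; omega
    have hsl : ∀ q, q ≠ p → (s.setLabel p (staticLabel I (descend x I (H - (d + 1))))).label q =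
        s.label q := by intro q hq; simp [ETState.setLabel, hq]
    have hso : ∀ q, (s.setLabel p (staticLabel I (descend x I (H - (d + 1))))).occ q =
        s.occ q := by intro q; simp [ETState.setLabel]
    have hne : ∀ b q, (p ++ [b]) <+: q → q ≠ p := by
      rintro b q hq rfl
      have := hq.length_le; simp at this
    obtain ⟨s', h1, h2, h3⟩ := ih (p ++ [false])
      (s.setLabel p (staticLabel I (descend x I (H - (d + 1))))) (by omega) (by
        intro q hq
        rw [hsl q (hne _ q hq), hso]
        exact hs q ((List.prefix_append _ _).trans hq))
    refine ⟨s', ?_, ⟨by omega, ?_, h2, ?_⟩, ?_⟩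
    · rw [etInsert, (hs p List.prefix_rfl).1]
      simp only [e]
      exact h1
    · rw [(h3 p (by intro h; have := h.length_le; simp at this)).1,
        descend_take _ _ _ _ (by omega)]
      simp [ETState.setLabel]
    · intro q hq
      have := h3 q (not_pre_lr (b := true) hq)
      rw [this.1, this.2, hsl q (hne _ q hq), hso]
      exact hs q ((List.prefix_append _ _).trans hq)
    · intro q hq
      have := h3 q (fun h => hq ((List.prefix_append _ _).trans h))
      rw [this.1, this.2, hsl q (by rintro rfl; exact hq List.prefix_rfl), hso]
      exact ⟨rfl, rfl⟩

theorem etInsert_spec (H : ℕ) (I : ℝ × ℝ) (hI : I.1 ≤ I.2) (x : ℝ) (hx : I.1 ≤ x ∧ x < I.2)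
    (T : ETree) (d : ℕ) (p u : List Bool) (s : ETState) (pl : ℝ × ℝ)
    (hR : TRep I s d p T) (hW : T.Wf H I d u)
    (hpl : T = .emp → pl = staticLabel I u ∧ u.length + d + 1 = H ∧ u <+: descend x I H) :
    (ETree.ins H x (descend x I H) d T = none → etInsert d p pl x s = (false, s)) ∧
    (∀ T', ETree.ins H x (descend x I H) d T = some T' →
      ∃ s', etInsert d p pl x s = (true, s') ∧ TRep I s' d p T' ∧
      ∀ q, ¬ p <+: q → s'.label q = s.label q ∧ s'.occ q = s.occ q) := by
  induction T generalizing d p u s pl with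
  | emp =>
    obtain ⟨rfl, h2, h3⟩ := hpl rfl
    refine ⟨by simp [ETree.ins], ?_⟩
    intro T' hT'
    simp only [ETree.ins, Option.some.injEq] at hT'; subst hT'
    have : u = descend x I (H - (d + 1)) := by
      rw [List.prefix_iff_eq_take] at h3
      rw [h3, descend_take _ _ _ _ (by omega)]; congr 1; omega
    rw [this]
    exact etInsert_fresh H I x d p s (by omega) hR
  | leaf y =>
    obtain ⟨rfl, h2, h3⟩ := hR
    refine ⟨?_, by simp [ETree.ins]⟩
    intro _
    rw [etInsert]
    cases h : s.label p with
    | none => exact absurd h h2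
    | some J => rfl
  | nd w l r ihl ihr =>
    obtain ⟨hd, hlab, hRl, hRr⟩ := hR
    obtain ⟨h1, h2, h3, h4, h5, h6⟩ := hW
    obtain ⟨d, rfl⟩ : ∃ e, d = e + 1 := ⟨d - 1, by omega⟩
    simp only [Nat.add_sub_cancel] at *
    by_cases hw : w <+: descend x I H
    · have hadm := mem_sl_of_prefix x I hx H w hw
      obtain ⟨al, bl⟩ := ihl d (p ++ [false]) w s (staticLabel I w) hRl h4
        (fun _ => ⟨rfl, by omega, hw⟩)
      obtain ⟨ar, br⟩ := ihr d (p ++ [true]) w s (staticLabel I w) hRr h5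
        (fun _ => ⟨rfl, by omega, hw⟩)
      have hstep : etInsert (d + 1) p pl x s =
          match etInsert d (p ++ [false]) (staticLabel I w) x s with
          | (true, s') => (true, s')
          | (false, s') => etInsert d (p ++ [true]) (staticLabel I w) x s' := by
        rw [etInsert, hlab]; simp only [if_pos hadm]
      have hpp : ∀ b, ¬ (p ++ [b]) <+: p := by
        intro b h; have := h.length_le; simp at this
      constructor
      · intro hn
        rw [ETree.ins, if_pos hw] at hn
        simp only [Nat.add_sub_cancel] at hn
        rcases hl : ETree.ins H x (descend x I H) d l with _ | l'
        · rw [hl] at hn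
          simp only [Option.map_eq_none_iff] at hn
          rw [hstep, al hl]; exact ar hn
        · rw [hl] at hn; simp at hn
      · intro T' hT'
        obtain ⟨-, ⟨l', hl', rfl⟩ | ⟨hl0, r', hr', rfl⟩⟩ := ETree.ins_nd hT'
        · obtain ⟨s', e1, e2, e3⟩ := bl l' hl'
          refine ⟨s', by rw [hstep, e1], ⟨by omega, ?_, e2, ?_⟩, ?_⟩
          · rw [(e3 p (hpp _)).1, hlab]
          · exact hRr.congr fun q hq => e3 q (not_pre_lr (b := true) hq)
          · exact fun q hq => e3 q fun h => hq ((List.prefix_append _ _).trans h)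
        · obtain ⟨s', e1, e2, e3⟩ := br r' hr'
          refine ⟨s', by rw [hstep, al hl0]; exact e1, ⟨by omega, ?_, ?_, e2⟩, ?_⟩
          · rw [(e3 p (hpp _)).1, hlab]
          · exact hRl.congr fun q hq => e3 q (not_pre_lr (b := false) hq)
          · exact fun q hq => e3 q fun h => hq ((List.prefix_append _ _).trans h)
    · refine ⟨?_, ?_⟩
      · intro _
        rw [etInsert, hlab]
        have : ¬ ((staticLabel I w).1 ≤ x ∧ x < (staticLabel I w).2) := fun h =>
          hw (prefix_of_mem_sl x I hI H w (by omega) h)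
        simp only [if_neg this]
      · intro T' hT'
        exact absurd (ETree.ins_nd hT').1 hw

theorem pathOfIdx_lo (d i : ℕ) (h : i < 2 ^ d) :
    pathOfIdx (d + 1) i = false :: pathOfIdx d i := by
  simp only [pathOfIdx, List.range_succ_eq_map, List.map_cons, List.map_map]
  congr 1
  · simp [Nat.testBit_lt_two_pow h]
  · apply List.map_congr_left
    intro k hk
    simp only [Function.comp]
    congr 1; omega

theorem pathOfIdx_hi (d i : ℕ) (h : i < 2 ^ d) :
    pathOfIdx (d + 1) (2 ^ d + i) = true :: pathOfIdx d i := by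
  simp only [pathOfIdx, List.range_succ_eq_map, List.map_cons, List.map_map]
  congr 1
  · simp [Nat.testBit_two_pow_add_eq, Nat.testBit_lt_two_pow h]
  · apply List.map_congr_left
    intro k hk
    rw [List.mem_range] at hk
    simp only [Function.comp]
    rw [Nat.testBit_two_pow_add_gt (by omega)]
    congr 1; omega

theorem TRep.elems_eq {I : ℝ × ℝ} {s : ETState} {d : ℕ} {p : List Bool} {T : ETree}
    (h : TRep I s d p T) :
    (List.range (2 ^ d)).filterMap (fun i => s.occ (p ++ pathOfIdx d i)) = T.elems := by
  induction T generalizing d p with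
  | emp =>
    rw [ETree.elems, List.filterMap_eq_nil_iff]
    intro i _
    exact (h _ (List.prefix_append _ _)).2
  | leaf x =>
    obtain ⟨rfl, h2, h3⟩ := h
    simp [pathOfIdx, h3, ETree.elems]
  | nd w l r ihl ihr =>
    obtain ⟨hd, hlab, hl, hr⟩ := h
    obtain ⟨d, rfl⟩ : ∃ e, d = e + 1 := ⟨d - 1, by omega⟩
    simp only [Nat.add_sub_cancel] at *
    rw [pow_succ, mul_two, List.range_add, List.filterMap_append, List.filterMap_map, ETree.elems,
      ← ihl hl, ← ihr hr]
    congr 1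
    · apply List.filterMap_congr
      intro i hi
      rw [pathOfIdx_lo d i (List.mem_range.1 hi)]; simp
    · apply List.filterMap_congr
      intro i hi
      simp only [Function.comp]
      rw [pathOfIdx_hi d i (List.mem_range.1 hi)]; simp
/-! ### The ensemble invariant -/

abbrev Tag := List Bool ⊕ ℕ

def getT (s : EnsState) : Tag → ETState
  | .inl p => s.A p
  | .inr j => s.B j

def TVal (H α : ℕ) : Tag → Prop
  | .inl p => p.length < H
  | .inr j => j < α

def hgt (H : ℕ) : Tag → ℕ
  | .inl p => H - p.length
  | .inr _ => H

def rwd : Tag → List Bool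
  | .inl p => p
  | .inr _ => []

def rk (H : ℕ) : Tag → ℕ
  | .inl p => H - p.length
  | .inr j => H + 1 + j

def ctTags : ℕ → List Bool → List (List Bool)
  | 0, _ => []
  | ht + 1, p => ctTags ht (p ++ [false]) ++ [p] ++ ctTags ht (p ++ [true])

def tagsL (H α : ℕ) : List Tag := (ctTags H []).map Sum.inl ++ (List.range α).map Sum.inr

theorem mem_ctTags (ht : ℕ) (p q : List Bool) :
    q ∈ ctTags ht p ↔ p <+: q ∧ q.length < p.length + ht := by
  induction ht generalizing p with
  | zero =>
    simp only [ctTags, List.not_mem_nil, false_iff, not_and]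
    intro h; have := h.length_le; omega
  | succ ht ih =>
    simp only [ctTags, List.mem_append, ih, List.mem_singleton, List.length_append,
      List.length_cons, List.length_nil]
    constructor
    · rintro ((⟨h1, h2⟩ | rfl) | ⟨h1, h2⟩)
      · exact ⟨(List.prefix_append _ _).trans h1, by omega⟩
      · exact ⟨List.prefix_rfl, by omega⟩
      · exact ⟨(List.prefix_append _ _).trans h1, by omega⟩
    · rintro ⟨⟨r, rfl⟩, h2⟩
      cases r with
      | nil => simp
      | cons b r =>
        simp only [List.length_append, List.length_cons] at h2
        cases b
        · exact Or.inl (Or.inl ⟨⟨r, by simp⟩, by simp; omega⟩)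
        · exact Or.inr ⟨⟨r, by simp⟩, by simp; omega⟩

theorem nodup_ctTags (ht : ℕ) (p : List Bool) : (ctTags ht p).Nodup := by
  induction ht generalizing p with
  | zero => simp [ctTags]
  | succ ht ih =>
    have hp : ∀ b, p ∉ ctTags ht (p ++ [b]) := by
      intro b h
      have := ((mem_ctTags _ _ _).1 h).1.length_le
      simp at this
    simp only [ctTags]
    rw [List.nodup_append, List.nodup_append]
    refine ⟨⟨ih _, by simp, ?_⟩, ih _, ?_⟩
    · intro a ha b hb hab
      rw [List.mem_singleton] at hb; subst hb hab
      exact hp _ ha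
    · intro a ha b hb hab
      subst hab
      rw [List.mem_append, List.mem_singleton] at ha
      rcases ha with ha | rfl
      · exact not_pre_lr ((mem_ctTags _ _ _).1 ha).1 ((mem_ctTags _ _ _).1 hb).1
      · exact hp _ hb

theorem mem_tagsL (H α : ℕ) (t : Tag) : t ∈ tagsL H α ↔ TVal H α t := by
  cases t <;> simp [tagsL, TVal, mem_ctTags]

theorem nodup_tagsL (H α : ℕ) : (tagsL H α).Nodup := by
  rw [tagsL, List.nodup_append]
  refine ⟨(nodup_ctTags _ _).map Sum.inl_injective, List.nodup_range.map Sum.inr_injective, ?_⟩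
  intro a ha b hb hab
  rw [List.mem_map] at ha hb
  obtain ⟨_, _, rfl⟩ := ha
  obtain ⟨_, _, rfl⟩ := hb
  simp at hab

def TV (H α : ℕ) : Finset Tag := (tagsL H α).toFinset

theorem mem_TV (H α : ℕ) (t : Tag) : t ∈ TV H α ↔ TVal H α t := by
  simp [TV, mem_tagsL]

structure EInv (H α : ℕ) (I : ℝ × ℝ) (n : ℕ) (s : EnsState) (st : Tag → ETree) : Prop where
  rep : ∀ t, TVal H α t → TRep I (getT s t) (hgt H t) [] (st t)
  wf : ∀ t, TVal H α t → (st t).Wf H I (hgt H t) (rwd t)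
  root : ∀ t, TVal H α t → ∃ l r, st t = .nd (rwd t) l r
  g1 : ∀ t, TVal H α t → (st t).opens.Pairwise (fun a b => ¬ a <+: b)
  g2 : ∀ t t', TVal H α t → TVal H α t' → rk H t < rk H t' →
    ∀ a ∈ (st t).opens, ∀ b ∈ (st t').opens, b ≠ [] → ¬ a <+: b
  cnt : ∑ t ∈ TV H α, (st t).elems.length ≤ n

theorem EInv.init (H α : ℕ) (hH : 0 < H) (I : ℝ × ℝ) :
    EInv H α I 0 (ensInit I) (fun t => .nd (rwd t) .emp .emp) := by
  have hne : ∀ b (q : List Bool), ([] ++ [b]) <+: q → q ≠ [] := by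
    rintro b q h rfl; simp at h
  refine ⟨?_, ?_, fun t _ => ⟨_, _, rfl⟩, ?_, ?_, ?_⟩
  · intro t ht
    have e : getT (ensInit I) t = ETState.init (staticLabel I (rwd t)) := by
      cases t <;> rfl
    rw [e]
    refine ⟨?_, by simp [ETState.init], ?_, ?_⟩
    · cases t <;> simp [hgt, TVal] at ht ⊢ <;> omega
    · intro q hq; simp [ETState.init, hne _ q hq]
    · intro q hq; simp [ETState.init, hne _ q hq]
  · intro t ht
    refine ⟨List.prefix_rfl, ?_, ?_, trivial, trivial, fun _ => rfl⟩
    · cases t <;> simp [hgt, TVal, rwd] at ht ⊢; omega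
    · cases t <;> simp [hgt, TVal] at ht ⊢ <;> omega
  · intro t ht; simp [ETree.opens]
  · intro t t' ht ht' hlt a ha b hb hb0
    simp [ETree.opens] at ha hb
    subst ha hb
    cases t' with
    | inr j => simp [rwd] at hb0
    | inl p' =>
      cases t with
      | inl p =>
        intro h; have := h.length_le
        simp [rk, rwd, TVal] at *; omega
      | inr j => simp [rk] at hlt; omega
  · simp [ETree.elems]
theorem EInv.step {H α : ℕ} {I : ℝ × ℝ} {n : ℕ} {s : EnsState} {st : Tag → ETree}
    (h : EInv H α I n s st) {x : ℝ} (hx : I.1 ≤ x ∧ x < I.2) {t : Tag} (ht : TVal H α t)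
    {T' : ETree} (hT : ETree.ins H x (descend x I H) (hgt H t) (st t) = some T')
    (hf : ∀ t', TVal H α t' → rk H t' < rk H t →
      ETree.ins H x (descend x I H) (hgt H t') (st t') = none)
    {s' : ETState} (hR : TRep I s' (hgt H t) [] T') {s2 : EnsState}
    (hs2 : getT s2 t = s') (hs2' : ∀ t', t' ≠ t → getT s2 t' = getT s t') :
    EInv H α I (n + 1) s2 (Function.update st t T') := by
  obtain ⟨l, r, hroot⟩ := h.root t ht
  have hwf := h.wf t ht
  have hne : st t ≠ .emp := by rw [hroot]; simp
  obtain ⟨L1, v, L2, C, e1, e2, e3, e4, e5, e6⟩ :=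
    ETree.ins_opens (descend_length x I H) hwf hne hT
  have hpre : rwd t <+: descend x I H := by
    rw [hroot] at hT; exact (ETree.ins_nd hT).1
  have hlen : (rwd t).length + hgt H t ≤ H := by
    cases t <;> simp [rwd, hgt, TVal] at ht ⊢; omega
  have hw' := ETree.ins_wf hx hwf hpre hlen hT
  have g1 := h.g1 t ht
  rw [e1, List.pairwise_append] at g1
  obtain ⟨a1, a2, a3⟩ := g1
  rw [List.pairwise_cons] at a2
  refine ⟨?_, ?_, ?_, ?_, ?_, ?_⟩
  · intro t' ht'
    by_cases e : t' = t
    · subst e; rw [hs2]; simpa using hR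
    · rw [hs2' t' e, Function.update_of_ne e]; exact h.rep t' ht'
  · intro t' ht'
    by_cases e : t' = t
    · subst e; simpa using hw'.1
    · rw [Function.update_of_ne e]; exact h.wf t' ht'
  · intro t' ht'
    by_cases e : t' = t
    · subst e
      rw [hroot] at hT
      rcases (ETree.ins_nd hT).2 with ⟨l', _, rfl⟩ | ⟨_, r', _, rfl⟩ <;> simp
    · rw [Function.update_of_ne e]; exact h.root t' ht'
  · intro t' ht'
    by_cases e : t' = t
    · subst e
      simp only [Function.update_self]
      rw [e2, List.pairwise_append, List.pairwise_append]
      refine ⟨⟨a1, e6, ?_⟩, a2.2, ?_⟩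
      · intro a ha c hc hac
        exact e3 a ha (hac.trans (e5 c hc).1)
      · intro a ha b hb hab
        rw [List.mem_append] at ha
        rcases ha with ha | ha
        · exact a3 a ha b (List.mem_cons_of_mem _ hb) hab
        · exact a2.1 b hb ((e5 a ha).2.trans hab)
    · rw [Function.update_of_ne e]; exact h.g1 t' ht'
  · intro t1 t2 h1 h2 hlt a ha b hb hb0 hab
    by_cases e : t1 = t
    · subst e
      have e' : t2 ≠ t1 := by rintro rfl; omega
      rw [Function.update_of_ne e'] at hb
      simp only [Function.update_self] at ha
      rw [e2, List.mem_append, List.mem_append] at ha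
      have old := h.g2 t1 t2 h1 h2 hlt
      rw [e1] at old
      rcases ha with (ha | ha) | ha
      · exact old a (by simp [ha]) b hb hb0 hab
      · exact old v (by simp) b hb hb0 ((e5 a ha).2.trans hab)
      · exact old a (by simp [ha]) b hb hb0 hab
    · rw [Function.update_of_ne e] at ha
      by_cases e' : t2 = t
      · subst e'
        simp only [Function.update_self] at hb
        rw [e2, List.mem_append, List.mem_append] at hb
        have old := h.g2 t1 t2 h1 h2 hlt
        rw [e1] at old
        rcases hb with (hb | hb) | hb
        · exact old a ha b (by simp [hb]) hb0 hab
        · exact ETree.ins_none (h.wf t1 h1) (hf t1 h1 hlt) a ha (hab.trans (e5 b hb).1)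
        · exact old a ha b (by simp [hb]) hb0 hab
      · rw [Function.update_of_ne e'] at hb
        exact h.g2 t1 t2 h1 h2 hlt a ha b hb hb0 hab
  · have hmem : t ∈ TV H α := (mem_TV _ _ _).2 ht
    have hc := h.cnt
    rw [← Finset.add_sum_erase _ _ hmem] at hc ⊢
    have : ∑ t' ∈ (TV H α).erase t, (Function.update st t T' t').elems.length =
        ∑ t' ∈ (TV H α).erase t, (st t').elems.length := by
      apply Finset.sum_congr rfl
      intro t' ht'
      rw [Function.update_of_ne (Finset.ne_of_mem_erase ht')]
    rw [this, Function.update_self, hw'.2]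
    omega

theorem EInv.mono {H α : ℕ} {I : ℝ × ℝ} {n m : ℕ} {s : EnsState} {st : Tag → ETree}
    (h : EInv H α I n s st) (hm : n ≤ m) : EInv H α I m s st :=
  ⟨h.rep, h.wf, h.root, h.g1, h.g2, h.cnt.trans hm⟩

theorem EInv.top {H α : ℕ} {I : ℝ × ℝ} (hI : I.1 ≤ I.2) {n : ℕ} {s : EnsState} {st : Tag → ETree}
    (h : EInv H α I n s st) {x : ℝ} (hx : I.1 ≤ x ∧ x < I.2) {t : Tag} (ht : TVal H α t) :
    (ETree.ins H x (descend x I H) (hgt H t) (st t) = none →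
      etInsertTop (hgt H t) x (getT s t) = (false, getT s t)) ∧
    (∀ T', ETree.ins H x (descend x I H) (hgt H t) (st t) = some T' →
      ∃ s', etInsertTop (hgt H t) x (getT s t) = (true, s') ∧ TRep I s' (hgt H t) [] T') := by
  obtain ⟨l, r, hroot⟩ := h.root t ht
  have := etInsert_spec H I hI x hx (st t) (hgt H t) [] (rwd t) (getT s t)
    (((getT s t).label []).getD (0, 1)) (h.rep t ht) (h.wf t ht) (by rw [hroot]; simp)
  refine ⟨this.1, fun T' hT' => ?_⟩
  obtain ⟨s', e1, e2, _⟩ := this.2 T' hT'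
  exact ⟨s', e1, e2⟩

theorem tryNodes_spec (x : ℝ) (g : List Bool × ℕ → Option ETree) (R : List Bool × ℕ → ETState → ETree → Prop)
    (l : List (List Bool × ℕ)) (f : CTState)
    (h : ∀ a ∈ l, (g a = none → etInsertTop a.2 x (f a.1) = (false, f a.1)) ∧
      ∀ T', g a = some T' → ∃ s', etInsertTop a.2 x (f a.1) = (true, s') ∧ R a s' T') :
    (tryNodes x l f = (false, f) ∧ ∀ a ∈ l, g a = none) ∨
    ∃ l1 a l2 T' s', l = l1 ++ a :: l2 ∧ (∀ b ∈ l1, g b = none) ∧ g a = some T' ∧ R a s' T' ∧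
      tryNodes x l f = (true, fun q => if q = a.1 then s' else f q) := by
  induction l with
  | nil => left; simp [tryNodes]
  | cons a l ih =>
    obtain ⟨p, ht⟩ := a
    obtain ⟨h1, h2⟩ := h (p, ht) (by simp)
    cases hg : g (p, ht) with
    | some T' =>
      obtain ⟨s', e1, e2⟩ := h2 T' hg
      right
      refine ⟨[], (p, ht), l, T', s', rfl, by simp, hg, e2, ?_⟩
      simp only at e1
      rw [tryNodes, e1]
      rfl
    | none =>
      have e1 := h1 hg
      have e2 : tryNodes x ((p, ht) :: l) f = tryNodes x l f := by
        simp only at e1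
        rw [tryNodes, e1]
        simp only
        congr 1
        funext q
        split_ifs with hq
        · rw [hq]
        · rfl
      rw [e2]
      rcases ih (fun a ha => h a (List.mem_cons_of_mem _ ha)) with ⟨k1, k2⟩ | ⟨l1, a, l2, T', s', k1, k2, k3⟩
      · left
        refine ⟨k1, ?_⟩
        intro a ha
        rw [List.mem_cons] at ha
        rcases ha with rfl | ha
        · exact hg
        · exact k2 a ha
      · right
        refine ⟨(p, ht) :: l1, a, l2, T', s', by rw [k1]; rfl, ?_, k3⟩
        intro b hb
        rw [List.mem_cons] at hb
        rcases hb with rfl | hb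
        · exact hg
        · exact k2 b hb

theorem tryBs_spec (H : ℕ) (x : ℝ) (g : ℕ → Option ETree) (R : ℕ → ETState → ETree → Prop)
    (l : List ℕ) (f : ℕ → ETState)
    (h : ∀ a ∈ l, (g a = none → etInsertTop H x (f a) = (false, f a)) ∧
      ∀ T', g a = some T' → ∃ s', etInsertTop H x (f a) = (true, s') ∧ R a s' T') :
    (tryBs H x l f = (false, f) ∧ ∀ a ∈ l, g a = none) ∨
    ∃ l1 a l2 T' s', l = l1 ++ a :: l2 ∧ (∀ b ∈ l1, g b = none) ∧ g a = some T' ∧ R a s' T' ∧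
      tryBs H x l f = (true, fun q => if q = a then s' else f q) := by
  induction l with
  | nil => left; simp [tryBs]
  | cons a l ih =>
    obtain ⟨h1, h2⟩ := h a (by simp)
    cases hg : g a with
    | some T' =>
      obtain ⟨s', e1, e2⟩ := h2 T' hg
      right
      refine ⟨[], a, l, T', s', rfl, by simp, hg, e2, ?_⟩
      rw [tryBs, e1]
    | none =>
      have e1 := h1 hg
      have e2 : tryBs H x (a :: l) f = tryBs H x l f := by
        rw [tryBs, e1]
        simp only
        congr 1
        funext q
        split_ifs with hq
        · rw [hq]
        · rfl
      rw [e2]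
      rcases ih (fun a ha => h a (List.mem_cons_of_mem _ ha)) with ⟨k1, k2⟩ | ⟨l1, a', l2, T', s', k1, k2, k3⟩
      · left
        refine ⟨k1, ?_⟩
        intro a ha
        rw [List.mem_cons] at ha
        rcases ha with rfl | ha
        · exact hg
        · exact k2 a ha
      · right
        refine ⟨a :: l1, a', l2, T', s', by rw [k1]; rfl, ?_, k3⟩
        intro b hb
        rw [List.mem_cons] at hb
        rcases hb with rfl | hb
        · exact hg
        · exact k2 b hb

theorem EInv.insert {H α : ℕ} {I : ℝ × ℝ} (hI : I.1 ≤ I.2) {n : ℕ} {s : EnsState}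
    {st : Tag → ETree} (h : EInv H α I n s st) {x : ℝ} (hx : I.1 ≤ x ∧ x < I.2) :
    ∃ st', EInv H α I (n + 1) (ensInsert H α I x s).2 st' := by
  have hmem : ∀ a ∈ ctNodeSeq H I x, a.1.length < H ∧ a.2 = H - a.1.length := by
    intro a ha
    simp only [ctNodeSeq, List.mem_map, List.mem_range] at ha
    obtain ⟨i, hi, rfl⟩ := ha
    simp [descend_length]; omega
  have hall : ∀ p : List Bool, p.length < H → p <+: descend x I H →
      (p, H - p.length) ∈ ctNodeSeq H I x := by
    intro p hp hpx
    simp only [ctNodeSeq, List.mem_map, List.mem_range]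
    refine ⟨H - 1 - p.length, by omega, ?_⟩
    rw [List.prefix_iff_eq_take, descend_take _ _ _ _ (by omega)] at hpx
    rw [descend_take _ _ _ _ (by omega)]
    ext1
    · simp only; rw [show H - 1 - (H - 1 - p.length) = p.length by omega]; exact hpx.symm
    · simp only; omega
  have hpw : (ctNodeSeq H I x).Pairwise (fun a b => a.2 < b.2) := by
    rw [ctNodeSeq, List.pairwise_map]
    exact List.pairwise_lt_range.imp (by intro a b hab; simp only; omega)
  have hnp : ∀ p : List Bool, p.length < H → ¬ p <+: descend x I H →
      ETree.ins H x (descend x I H) (hgt H (.inl p)) (st (.inl p)) = none := by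
    intro p hp hpx
    obtain ⟨l, r, e⟩ := h.root (.inl p) hp
    rw [e, ETree.ins, if_neg]
    exact hpx
  rcases tryNodes_spec x
    (fun a => ETree.ins H x (descend x I H) (hgt H (.inl a.1)) (st (.inl a.1)))
    (fun a s' T' => TRep I s' (hgt H (.inl a.1)) [] T') (ctNodeSeq H I x) s.A (by
      intro a ha
      obtain ⟨k1, k2⟩ := hmem a ha
      have := h.top hI hx (t := .inl a.1) k1
      rw [k2]
      exact this) with ⟨k1, k2⟩ | ⟨l1, a, l2, T', s', k1, k2, k3, k4, k5⟩
  · have hA : ∀ p : List Bool, p.length < H →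
        ETree.ins H x (descend x I H) (hgt H (.inl p)) (st (.inl p)) = none := by
      intro p hp
      by_cases hpx : p <+: descend x I H
      · exact k2 _ (hall p hp hpx)
      · exact hnp p hp hpx
    rcases tryBs_spec H x
      (fun j => ETree.ins H x (descend x I H) (hgt H (.inr j)) (st (.inr j)))
      (fun j s' T' => TRep I s' (hgt H (.inr j)) [] T') (List.range α) s.B (by
        intro j hj
        exact h.top hI hx (t := .inr j) (List.mem_range.1 hj)) with
      ⟨m1, m2⟩ | ⟨l1, j, l2, T', s', m1, m2, m3, m4, m5⟩
    · refine ⟨st, ?_⟩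
      have : (ensInsert H α I x s).2 = s := by
        rw [ensInsert, ctInsert, k1]; simp only [m1]
      rw [this]
      exact h.mono (by omega)
    · have hj : j < α := by
        rw [← List.mem_range, m1]; simp
      have : (ensInsert H α I x s).2 = ⟨s.A, fun q => if q = j then s' else s.B q⟩ := by
        rw [ensInsert, ctInsert, k1]; simp only [m5]
      rw [this]
      refine ⟨_, h.step hx (t := .inr j) hj m3 ?_ m4 (by simp [getT]) ?_⟩
      · intro t' ht' hlt
        cases t' with
        | inl p => exact hA p ht'
        | inr j' =>
          simp only [rk] at hlt
          have hj' : j' ∈ List.range α := List.mem_range.2 ht'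
          have pw : (List.range α).Pairwise (· < ·) := List.pairwise_lt_range
          rw [m1] at hj' pw
          rw [List.pairwise_append, List.pairwise_cons] at pw
          rw [List.mem_append, List.mem_cons] at hj'
          rcases hj' with hj' | rfl | hj'
          · exact m2 j' hj'
          · omega
          · have := pw.2.1.1 j' hj'; omega
      · intro t' ht'
        cases t' with
        | inl p => rfl
        | inr j' =>
          have : j' ≠ j := by rintro rfl; exact ht' rfl
          simp [getT, this]
  · obtain ⟨q1, q2⟩ := hmem a (by rw [k1]; simp)
    have : (ensInsert H α I x s).2 = ⟨fun q => if q = a.1 then s' else s.A q, s.B⟩ := by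
      rw [ensInsert, ctInsert, k5]
    rw [this]
    refine ⟨_, h.step hx (t := .inl a.1) q1 k3 ?_ k4 (by simp [getT]) ?_⟩
    · intro t' ht' hlt
      cases t' with
      | inr j' => simp only [rk] at hlt; omega
      | inl p =>
        simp only [rk] at hlt
        by_cases hpx : p <+: descend x I H
        · have hj' := hall p ht' hpx
          rw [k1] at hj' hpw
          rw [List.pairwise_append, List.pairwise_cons] at hpw
          rw [List.mem_append, List.mem_cons] at hj'
          rcases hj' with hj' | e | hj'
          · exact k2 _ hj'
          · rw [← e] at hlt; simp at hlt
          · have := hpw.2.1.1 _ hj'; simp only at this; omega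
        · exact hnp p ht' hpx
    · intro t' ht'
      cases t' with
      | inr j => rfl
      | inl p =>
        have : p ≠ a.1 := by rintro rfl; exact ht' rfl
        simp [getT, this]

theorem EInv.run {H α : ℕ} (hH : 0 < H) {I : ℝ × ℝ} (hI : I.1 ≤ I.2) (xs : List ℝ)
    (hxs : ∀ x ∈ xs, x ∈ Set.Ico I.1 I.2) :
    ∃ st, EInv H α I xs.length (ensRun H α I xs).2 st := by
  have key : ∀ (xs : List ℝ) (acc : Bool × EnsState) (n : ℕ) (st : Tag → ETree),
      (∀ x ∈ xs, x ∈ Set.Ico I.1 I.2) → EInv H α I n acc.2 st →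
      ∃ st', EInv H α I (n + xs.length) (xs.foldl (fun acc x =>
        let r := ensInsert H α I x acc.2
        (acc.1 && r.1, r.2)) acc).2 st' := by
    intro xs
    induction xs with
    | nil => intro acc n st _ h; exact ⟨st, h⟩
    | cons x xs ih =>
      intro acc n st hx h
      obtain ⟨st1, h1⟩ := h.insert hI (hx x (by simp))
      obtain ⟨st2, h2⟩ := ih (acc.1 && (ensInsert H α I x acc.2).1, (ensInsert H α I x acc.2).2)
        (n + 1) st1 (fun y hy => hx y (List.mem_cons_of_mem _ hy)) h1
      refine ⟨st2, ?_⟩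
      rw [List.foldl_cons, List.length_cons, show n + (xs.length + 1) = n + 1 + xs.length by omega]
      exact h2
  obtain ⟨st, h⟩ := key xs (true, ensInit I) 0 _ hxs (EInv.init H α hH I)
  exact ⟨st, by simpa [ensRun] using h⟩
/-! ### Counting -/

theorem ETree.Wf.closed_lt {H : ℕ} {I : ℝ × ℝ} {d : ℕ} {u : List Bool} {T : ETree}
    (h : T.Wf H I d u) : ∀ a ∈ T.closed, a.length < H := by
  induction T generalizing d u with
  | emp => simp [closed]
  | leaf x => simp [closed]
  | nd w l r ihl ihr =>
    obtain ⟨h1, h2, h3, h4, h5, h6⟩ := h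
    intro a ha
    simp only [closed, List.mem_append] at ha
    rcases ha with (ha | ha) | ha
    · exact ihl h4 a ha
    · exact ihr h5 a ha
    · split_ifs at ha
      · simp at ha
      · simp at ha; subst ha; omega

def Ncl (H α : ℕ) (st : Tag → ETree) (m : ℕ) : ℕ := ∑ t ∈ TV H α, (st t).cl m

def Rt (H α : ℕ) (m : ℕ) : ℕ := ∑ t ∈ TV H α, if m + hgt H t = H then 1 else 0

def Lv (H α : ℕ) (st : Tag → ETree) (m : ℕ) : ℕ := ∑ t ∈ TV H α, ((st t).lev H).count m

def zi (st : Tag → ETree) (m : ℕ) : Tag → ℕ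
  | .inl p => if p.length = m ∧ (st (.inl p)).elems ≠ [] then 1 else 0
  | .inr _ => 0

theorem EInv.open_le {H α : ℕ} {I : ℝ × ℝ} {n : ℕ} {s : EnsState} {st : Tag → ETree}
    (h : EInv H α I n s st) {m : ℕ} (hm : 0 < m) (hmH : m < H) :
    ∑ t ∈ TV H α, (st t).op m ≤ Rt H α m := by
  have e1 : ∀ t ∈ TV H α, (st t).op m =
      ((st t).opens.toFinset.filter (fun w => w.length = m)).card := by
    intro t ht
    have hnd : (st t).opens.Nodup := (h.g1 t ((mem_TV _ _ _).1 ht)).imp (by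
      rintro a b hab rfl; exact hab List.prefix_rfl)
    rw [ETree.op, List.countP_eq_length_filter, ← List.toFinset_card_of_nodup (hnd.filter _)]
    congr 1; ext w; simp
  rw [Finset.sum_congr rfl e1, ← Finset.card_sigma, Rt, ← Finset.card_filter]
  apply Finset.card_le_card_of_injOn (fun z => (Sum.inl z.2 : Tag))
  · rintro ⟨t, w⟩ hz
    simp only [Finset.coe_sigma, Set.mem_sigma_iff, Finset.mem_coe, Finset.mem_filter] at hz
    have hl : w.length = m := hz.2.2
    refine Finset.mem_coe.2 (Finset.mem_filter.2 ⟨(mem_TV _ _ _).2 ?_, ?_⟩)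
    · simp only [TVal]; omega
    · simp only [hgt]; omega
  · rintro ⟨t, w⟩ hz ⟨t', w'⟩ hz' e
    simp only [Finset.coe_sigma, Set.mem_sigma_iff, Finset.mem_coe, Finset.mem_filter,
      List.mem_toFinset, mem_TV] at hz hz'
    simp only [Sum.inl.injEq] at e
    subst e
    have hw0 : w ≠ [] := by rintro rfl; simp at hz; omega
    have : t = t' := by
      rcases lt_trichotomy (rk H t) (rk H t') with hlt | heq | hlt
      · exact absurd List.prefix_rfl (h.g2 t t' hz.1 hz'.1 hlt w hz.2.1 w hz'.2.1 hw0)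
      · have p1 := (h.wf t hz.1).opens_ext w hz.2.1
        have p2 := (h.wf t' hz'.1).opens_ext w hz'.2.1
        cases t with
        | inl p =>
          cases t' with
          | inl p' =>
            simp only [rk, rwd, TVal] at *
            have := List.prefix_of_prefix_length_le p1 p2 (by omega)
            rw [this.eq_of_length (by omega)]
          | inr j => simp only [rk, TVal] at *; omega
        | inr j =>
          cases t' with
          | inl p' => simp only [rk, TVal] at *; omega
          | inr j' => simp only [rk] at heq; congr 1; omega
      · exact absurd List.prefix_rfl (h.g2 t' t hz'.1 hz.1 hlt w hz'.2.1 w hz.2.1 hw0)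
    subst this; rfl

theorem EInv.lv_le {H α : ℕ} {I : ℝ × ℝ} {n : ℕ} {s : EnsState} {st : Tag → ETree}
    (h : EInv H α I n s st) {m : ℕ} (hm : 0 < m) (hmH : m < H) :
    Lv H α st m ≤ Rt H α m + Ncl H α st m := by
  have : Lv H α st m = ∑ t ∈ TV H α, (st t).op m + Ncl H α st m := by
    rw [Lv, Ncl, ← Finset.sum_add_distrib]
    exact Finset.sum_congr rfl fun t _ => ETree.lev_eq hmH _
  rw [this]
  exact Nat.add_le_add_right (h.open_le hm hmH) _

theorem EInv.lv_ge {H α : ℕ} {I : ℝ × ℝ} {n : ℕ} {s : EnsState} {st : Tag → ETree}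
    (h : EInv H α I n s st) (m : ℕ) :
    Rt H α (m + 1) + 2 * Ncl H α st m ≤ Lv H α st (m + 1) := by
  rw [Lv, Ncl, Rt, Finset.mul_sum, ← Finset.sum_add_distrib]
  apply Finset.sum_le_sum
  intro t ht
  rw [mem_TV] at ht
  have := ETree.lev_ge (m := m) (h.wf t ht)
  obtain ⟨l, r, e⟩ := h.root t ht
  have hne : st t ≠ .emp := by rw [e]; simp
  simpa [hne] using this

theorem EInv.lv_ge' {H α : ℕ} {I : ℝ × ℝ} {n : ℕ} {s : EnsState} {st : Tag → ETree}
    (h : EInv H α I n s st) (m : ℕ) :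
    Rt H α (m + 1) + ∑ t ∈ TV H α, zi st m t ≤ Lv H α st (m + 1) := by
  rw [Lv, Rt, ← Finset.sum_add_distrib]
  apply Finset.sum_le_sum
  intro t ht
  rw [mem_TV] at ht
  have h1 := ETree.lev_ge (m := m) (h.wf t ht)
  obtain ⟨l, r, e⟩ := h.root t ht
  have hne : st t ≠ .emp := by rw [e]; simp
  simp only [ne_eq, hne, not_false_eq_true, true_and] at h1
  have hz : zi st m t = 0 ∨ (zi st m t = 1 ∧ m + hgt H t = H ∧
      1 ≤ ((st t).lev H).count (m + 1)) := by
    cases t with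
    | inr j => left; rfl
    | inl p =>
      by_cases hc : p.length = m ∧ (st (.inl p)).elems ≠ []
      · right
        refine ⟨by simp only [zi, if_pos hc], by simp only [hgt, TVal] at *; omega, ?_⟩
        have hw := h.wf _ ht
        have hc2 := hc.2
        rw [e] at hw hc2 ⊢
        have := ETree.lev_root hw hc2
        simp only [rwd, hc.1] at this ⊢
        exact this
      · left; simp only [zi, if_neg hc]
  rcases hz with hz | ⟨hz, h3, h4⟩
  · rw [hz]; omega
  · rw [hz, if_neg (by omega)]; omega

theorem EInv.ncl {H α : ℕ} {I : ℝ × ℝ} {n : ℕ} {s : EnsState} {st : Tag → ETree}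
    (h : EInv H α I n s st) (k m : ℕ) (hk : m + (k + 1) = H) :
    Ncl H α st m * 2 ^ (k + 1) ≤ n := by
  induction k generalizing m with
  | zero =>
    have h1 := h.lv_ge m
    have h2 : Lv H α st (m + 1) ≤ n := by
      refine le_trans (le_of_eq ?_) h.cnt
      rw [show m + 1 = H by omega]
      exact Finset.sum_congr rfl fun t ht => ETree.lev_top (h.wf t ((mem_TV _ _ _).1 ht))
    omega
  | succ k ih =>
    have h1 := h.lv_ge m
    have h2 := h.lv_le (m := m + 1) (by omega) (by omega)
    have h3 := ih (m + 1) (by omega)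
    have h4 : 2 * Ncl H α st m ≤ Ncl H α st (m + 1) := by omega
    calc Ncl H α st m * 2 ^ (k + 1 + 1) = (2 * Ncl H α st m) * 2 ^ (k + 1) := by ring
      _ ≤ Ncl H α st (m + 1) * 2 ^ (k + 1) := Nat.mul_le_mul_right _ h4
      _ ≤ n := h3

theorem EInv.ncl_real {H α : ℕ} {I : ℝ × ℝ} (hI : I.1 ≤ I.2) {n : ℕ} {s : EnsState}
    {st : Tag → ETree} (h : EInv H α I n s st) (m : ℕ) (hm : m < H) :
    (Ncl H α st m : ℝ) * ((I.2 - I.1) / 2 ^ m) ≤ n * ((I.2 - I.1) / 2 ^ H) := by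
  have h1 := h.ncl (H - m - 1) m (by omega)
  rw [show H - m - 1 + 1 = H - m by omega] at h1
  have h2 : (Ncl H α st m : ℝ) * 2 ^ (H - m) ≤ n := by exact_mod_cast h1
  have h3 : (2 : ℝ) ^ H = 2 ^ m * 2 ^ (H - m) := by rw [← pow_add]; congr 1; omega
  have h4 : (I.2 - I.1) / 2 ^ m = 2 ^ (H - m) * ((I.2 - I.1) / 2 ^ H) := by
    rw [h3]; field_simp
  rw [h4, ← mul_assoc]
  exact mul_le_mul_of_nonneg_right h2 (div_nonneg (by linarith) (by positivity))

theorem EInv.z_real {H α : ℕ} {I : ℝ × ℝ} (hI : I.1 ≤ I.2) {n : ℕ} {s : EnsState}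
    {st : Tag → ETree} (h : EInv H α I n s st) (m : ℕ) (hm : m + 1 < H) :
    ((∑ t ∈ TV H α, zi st m t : ℕ) : ℝ) * (4 * ((I.2 - I.1) / 2 ^ m)) ≤
      8 * (n * ((I.2 - I.1) / 2 ^ H)) := by
  have h1 := h.lv_ge' m
  have h2 := h.lv_le (m := m + 1) (by omega) hm
  have h3 : ((∑ t ∈ TV H α, zi st m t : ℕ) : ℝ) ≤ Ncl H α st (m + 1) := by
    exact_mod_cast (by omega : (∑ t ∈ TV H α, zi st m t) ≤ Ncl H α st (m + 1))
  have h4 := h.ncl_real hI (m + 1) hm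
  have h5 : (I.2 - I.1) / 2 ^ m = 2 * ((I.2 - I.1) / 2 ^ (m + 1)) := by
    rw [pow_succ]; field_simp
  have h6 : 0 ≤ (I.2 - I.1) / 2 ^ (m + 1) := div_nonneg (by linarith) (by positivity)
  rw [h5]
  nlinarith [mul_le_mul_of_nonneg_right h3 h6]

theorem sum_by_len (L : List (List Bool)) (H : ℕ) (g : ℕ → ℝ) (hL : ∀ a ∈ L, a.length < H) :
    (L.map fun w => g w.length).sum =
      ∑ m ∈ Finset.range H, (L.countP (fun w => w.length = m) : ℝ) * g m := by
  induction L with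
  | nil => simp
  | cons a L ih =>
    rw [List.map_cons, List.sum_cons, ih fun b hb => hL b (List.mem_cons_of_mem _ hb)]
    have ha := hL a (by simp)
    have : g a.length = ∑ m ∈ Finset.range H, (if a.length = m then 1 else 0) * g m := by
      simp [ha]
    rw [this, ← Finset.sum_add_distrib]
    apply Finset.sum_congr rfl
    intro m _
    rw [List.countP_cons]
    push_cast
    simp only [decide_eq_true_eq]
    split_ifs <;> ring

/-! ### Costs -/

def Blk (st : Tag → ETree) (t : Tag) : List (Tag × ℝ) := (st t).elems.map (Prod.mk t)

def fP (P : Tag → Tag → Prop) (a b : Tag × ℝ) : ℝ := if P a.1 b.1 then |a.2 - b.2| else 0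

theorem fP_nonneg (P : Tag → Tag → Prop) (a b : Tag × ℝ) : 0 ≤ fP P a b := by
  unfold fP; split_ifs <;> simp

theorem fP_le (P : Tag → Tag → Prop) (a b : Tag × ℝ) : fP P a b ≤ |a.2 - b.2| := by
  unfold fP; split_ifs <;> simp

theorem pairSum_eq (P : Tag → Tag → Prop) (H α : ℕ) (s : EnsState) :
    pairSum P (consecPairs H α s) = cs (fP P) (occSeq H α s) := by
  rw [cs_eq]; rfl

theorem occSeq_eq {H α : ℕ} {I : ℝ × ℝ} {n : ℕ} {s : EnsState} {st : Tag → ETree}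
    (h : EInv H α I n s st) : occSeq H α s = (tagsL H α).flatMap (Blk st) := by
  have hblk : ∀ t, TVal H α t → ((List.range (2 ^ hgt H t)).map fun i =>
      (t, (getT s t).occ (pathOfIdx (hgt H t) i))).filterMap
        (fun c : Tag × Option ℝ => c.2.map fun x => (c.1, x)) = Blk st t := by
    intro t ht
    have := (h.rep t ht).elems_eq
    rw [Blk, ← this, List.filterMap_map, List.map_filterMap]
    rfl
  have hA : ∀ ht p, p.length + ht = H → ((ctCellsAux ht p).map fun pq =>
      ((Sum.inl pq.1 : Tag), (s.A pq.1).occ pq.2)).filterMap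
        (fun c : Tag × Option ℝ => c.2.map fun x => (c.1, x)) =
      ((ctTags ht p).map Sum.inl).flatMap (Blk st) := by
    intro ht
    induction ht with
    | zero => intro p _; simp [ctCellsAux, ctTags]
    | succ ht ih =>
      intro p hp
      have hb := hblk (.inl p) (by simp only [TVal]; omega)
      have e : hgt H (.inl p) = ht + 1 := by simp only [hgt]; omega
      rw [e] at hb
      simp only [ctCellsAux, ctTags, List.map_append, List.filterMap_append, List.flatMap_append,
        ih (p ++ [false]) (by simp; omega), ih (p ++ [true]) (by simp; omega), List.map_map]
      simp only [List.map_cons, List.map_nil, List.flatMap_cons, List.flatMap_nil, List.append_nil]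
      rw [← hb]
      rfl
  have hB : ∀ l : List ℕ, (∀ j ∈ l, j < α) → (l.flatMap fun j =>
      (List.range (2 ^ H)).map fun i => ((Sum.inr j : Tag), (s.B j).occ (pathOfIdx H i))).filterMap
        (fun c : Tag × Option ℝ => c.2.map fun x => (c.1, x)) =
      (l.map Sum.inr).flatMap (Blk st) := by
    intro l
    induction l with
    | nil => simp
    | cons j l ih =>
      intro hl
      have hb := hblk (.inr j) (hl j (by simp))
      rw [List.flatMap_cons, List.filterMap_append, ih fun k hk => hl k (List.mem_cons_of_mem _ hk),
        List.map_cons, List.flatMap_cons, ← hb]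
      rfl
  rw [occSeq, ensCells, List.filterMap_append, hA H [] (by simp),
    hB _ (fun j hj => List.mem_range.1 hj), tagsL, List.flatMap_append]

theorem mem_blks {st : Tag → ETree} {ts : List Tag} {a : Tag × ℝ} (h : a ∈ ts.flatMap (Blk st)) :
    a.1 ∈ ts ∧ a.2 ∈ (st a.1).elems := by
  simp only [List.mem_flatMap, Blk, List.mem_map] at h
  obtain ⟨t, ht, x, hx, rfl⟩ := h
  exact ⟨ht, hx⟩

theorem type1_blks (st : Tag → ETree) (ts : List Tag) (hn : ts.Nodup) :
    cs (fP (fun t t' => t = t')) (ts.flatMap (Blk st)) ≤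
      (ts.map fun t => cs (fun x y => |x - y|) (st t).elems).sum := by
  induction ts with
  | nil => simp [cs]
  | cons t ts ih =>
    rw [List.nodup_cons] at hn
    rw [List.flatMap_cons, cs_append, List.map_cons, List.sum_cons]
    have h1 := ih hn.2
    have h2 : cs (fP (fun t t' => t = t')) (Blk st t) = cs (fun x y => |x - y|) (st t).elems := by
      rw [Blk, cs_map]; simp [fP]
    have h3 := br_le (fP (fun t t' => t = t')) (Blk st t) (ts.flatMap (Blk st)) 0 le_rfl (by
      intro a ha b hb
      have hb' := (mem_blks hb).1
      simp only [Blk, List.mem_map] at ha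
      obtain ⟨x, _, rfl⟩ := ha
      have : t ≠ b.1 := by intro e; rw [e] at hn; exact hn.1 hb'
      simp [fP, this])
    linarith

theorem type1 {H α : ℕ} {I : ℝ × ℝ} (hI : I.1 ≤ I.2) {n : ℕ} {s : EnsState} {st : Tag → ETree}
    (h : EInv H α I n s st) :
    cs (fP (fun t t' => t = t')) ((tagsL H α).flatMap (Blk st)) ≤
      (n : ℝ) * H * ((I.2 - I.1) / 2 ^ H) := by
  refine (type1_blks st _ (nodup_tagsL H α)).trans ?_
  rw [← List.sum_toFinset _ (nodup_tagsL H α)]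
  calc ∑ t ∈ TV H α, cs (fun x y => |x - y|) (st t).elems
      ≤ ∑ t ∈ TV H α, ∑ m ∈ Finset.range H, ((st t).cl m : ℝ) * ((I.2 - I.1) / 2 ^ m) := by
        apply Finset.sum_le_sum
        intro t ht
        have hw := h.wf t ((mem_TV _ _ _).1 ht)
        refine (ETree.cost_le hI hw).trans (le_of_eq ?_)
        exact sum_by_len (st t).closed H (fun m => (I.2 - I.1) / 2 ^ m) hw.closed_lt
    _ = ∑ m ∈ Finset.range H, (Ncl H α st m : ℝ) * ((I.2 - I.1) / 2 ^ m) := by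
        rw [Finset.sum_comm]
        apply Finset.sum_congr rfl
        intro m _
        rw [Ncl, Nat.cast_sum, Finset.sum_mul]
    _ ≤ ∑ m ∈ Finset.range H, (n : ℝ) * ((I.2 - I.1) / 2 ^ H) :=
        Finset.sum_le_sum fun m hm => h.ncl_real hI m (Finset.mem_range.1 hm)
    _ = (n : ℝ) * H * ((I.2 - I.1) / 2 ^ H) := by simp; ring

theorem type3 {H α : ℕ} {I : ℝ × ℝ} (hI : I.1 ≤ I.2) {n : ℕ} {s : EnsState} {st : Tag → ETree}
    (h : EInv H α I n s st) (P : Tag → Tag → Prop)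
    (hP : ∀ t t', P t t' → t ≠ t' ∧ ∃ j, t' = Sum.inr j) :
    cs (fP P) ((tagsL H α).flatMap (Blk st)) ≤ (α : ℝ) * (I.2 - I.1) := by
  have key : ∀ ts : List Tag, (∀ t ∈ ts, TVal H α t) →
      cs (fP P) (ts.flatMap (Blk st)) ≤ (ts.countP (fun t => t.isRight) : ℝ) * (I.2 - I.1) := by
    intro ts
    induction ts using List.reverseRecOn with
    | nil => simp [cs]
    | append_singleton ts t ih =>
      intro hts
      have h1 := ih fun t' ht' => hts t' (by simp [ht'])
      rw [List.flatMap_append, cs_append, List.countP_append]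
      have e : [t].flatMap (Blk st) = Blk st t := by simp
      rw [e]
      have h2 := cs_nonpos (fP P) (Blk st t) (by
        intro a ha b hb
        simp only [Blk, List.mem_map] at ha hb
        obtain ⟨x, _, rfl⟩ := ha
        obtain ⟨y, _, rfl⟩ := hb
        simp only [fP]
        rw [if_neg fun hh => (hP _ _ hh).1 rfl])
      have h3 := br_le (fP P) (ts.flatMap (Blk st)) (Blk st t)
        (if t.isRight then I.2 - I.1 else 0) (by split_ifs <;> linarith) (by
        intro a ha b hb
        have ha' := mem_blks ha
        have va := (h.wf a.1 (hts a.1 (by simp [ha'.1]))).elems_ext a.2 ha'.2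
        simp only [Blk, List.mem_map] at hb
        obtain ⟨y, hy, rfl⟩ := hb
        have vb := (h.wf t (hts t (by simp))).elems_ext y hy
        simp only [fP]
        split_ifs with c1 c2 c2
        · rw [abs_le]; constructor <;> linarith [va.2.1, va.2.2, vb.2.1, vb.2.2]
        · obtain ⟨j, rfl⟩ := (hP _ _ c1).2
          simp at c2
        · linarith
        · exact le_rfl)
      have h4 : (([t].countP (fun t => t.isRight) : ℕ) : ℝ) * (I.2 - I.1) =
          if t.isRight then I.2 - I.1 else 0 := by
        rw [List.countP_cons]; split_ifs <;> simp
      push_cast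
      rw [add_mul, h4]
      linarith
  refine (key _ fun t ht => (mem_tagsL _ _ _).1 ht).trans (le_of_eq ?_)
  have : (tagsL H α).countP (fun t => t.isRight) = α := by
    rw [tagsL, List.countP_append, List.countP_map, List.countP_map]
    simp [Function.comp_def]
  rw [this]

def P2 (t t' : Tag) : Prop := t ≠ t' ∧ (∃ p, t = Sum.inl p) ∧ ∃ p', t' = Sum.inl p'

def hfun (a b : Tag × ℝ) : ℝ := fP P2 a b - fP (fun t t' => t = t') a b - (b.2 - a.2)

def zc (H : ℕ) (I : ℝ × ℝ) (st : Tag → ETree) : Tag → ℝ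
  | .inl p => if p.length + 1 < H ∧ (st (.inl p)).elems ≠ [] then 4 * ((I.2 - I.1) / 2 ^ p.length) else 0
  | .inr _ => 0

theorem zc_eq (H : ℕ) (I : ℝ × ℝ) (st : Tag → ETree) (t : Tag) :
    zc H I st t = ∑ m ∈ Finset.range (H - 1), (zi st m t : ℝ) * (4 * ((I.2 - I.1) / 2 ^ m)) := by
  cases t with
  | inr j => simp [zc, zi]
  | inl p =>
    by_cases he : (st (.inl p)).elems = []
    · simp [zc, zi, he]
    · simp only [zc, zi, ne_eq, he, not_false_eq_true, and_true]
      simp only [Nat.cast_ite, Nat.cast_one, Nat.cast_zero, ite_mul, one_mul, zero_mul,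
        Finset.sum_ite_eq, Finset.mem_range]
      by_cases hc : p.length + 1 < H
      · rw [if_pos hc, if_pos (by omega)]
      · rw [if_neg hc, if_neg (by omega)]

theorem hfun_blks {H α : ℕ} {I : ℝ × ℝ} (hI : I.1 ≤ I.2) {n : ℕ} {s : EnsState} {st : Tag → ETree}
    (h : EInv H α I n s st) (ht : ℕ) (p : List Bool) (hp : p.length + ht = H) :
    cs hfun (((ctTags ht p).map Sum.inl).flatMap (Blk st)) ≤
      (((ctTags ht p).map Sum.inl).map (zc H I st)).sum := by
  induction ht generalizing p with
  | zero => simp [ctTags, cs]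
  | succ ht ih =>
    have hl := ih (p ++ [false]) (by simp; omega)
    have hr := ih (p ++ [true]) (by simp; omega)
    have hmem : ∀ b, ∀ a ∈ ((ctTags ht (p ++ [b])).map Sum.inl).flatMap (Blk st),
        (p ++ [b]) <+: descend a.2 I H ∧ I.1 ≤ a.2 ∧ a.2 < I.2 := by
      intro b a ha
      obtain ⟨h1, h2⟩ := mem_blks ha
      rw [List.mem_map] at h1
      obtain ⟨q, hq, e⟩ := h1
      rw [mem_ctTags] at hq
      rw [← e] at h2
      have := (h.wf (.inl q) (by simp at hq; simp only [TVal]; omega)).elems_ext _ h2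
      exact ⟨hq.1.trans this.1, this.2⟩
    have hM : ∀ a ∈ Blk st (.inl p), p <+: descend a.2 I H ∧ I.1 ≤ a.2 ∧ a.2 < I.2 := by
      intro a ha
      simp only [Blk, List.mem_map] at ha
      obtain ⟨x, hx, rfl⟩ := ha
      exact (h.wf (.inl p) (by simp only [TVal]; omega)).elems_ext _ hx
    have hcM : cs hfun (Blk st (.inl p)) ≤ 0 := by
      apply cs_nonpos
      intro a ha b hb
      simp only [Blk, List.mem_map] at ha hb
      obtain ⟨x, _, rfl⟩ := ha
      obtain ⟨y, _, rfl⟩ := hb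
      simp only [hfun, fP, P2, ne_eq, not_true_eq_false, false_and, if_false, if_true]
      linarith [le_abs_self (x - y)]
    have hpos : (0 : ℝ) ≤ (I.2 - I.1) / 2 ^ p.length := div_nonneg (by linarith) (by positivity)
    simp only [ctTags, List.map_append, List.map_cons, List.map_nil, List.flatMap_append,
      List.sum_append, List.flatMap_cons, List.flatMap_nil, List.append_nil, List.sum_cons,
      List.sum_nil]
    by_cases he : (st (.inl p)).elems = []
    · have e0 : Blk st (.inl p) = [] := by simp [Blk, he]
      rw [e0, List.append_nil, cs_append]
      have hb := br_le hfun (((ctTags ht (p ++ [false])).map Sum.inl).flatMap (Blk st))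
        (((ctTags ht (p ++ [true])).map Sum.inl).flatMap (Blk st)) 0 le_rfl (by
          intro a ha b hb
          have ka := hmem _ a ha
          have kb := hmem _ b hb
          have ka' := mem_sl_of_prefix a.2 I ka.2 H _ ka.1
          have kb' := mem_sl_of_prefix b.2 I kb.2 H _ kb.1
          rw [sl_append] at ka' kb'
          simp at ka' kb'
          have := fP_le P2 a b
          have := fP_nonneg (fun t t' => t = t') a b
          rw [abs_of_nonpos (by linarith)] at *
          simp only [hfun]
          linarith)
      simp only [zc, he, ne_eq, not_true_eq_false, and_false, if_false]
      linarith
    · by_cases h0 : ht = 0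
      · subst h0
        simp only [ctTags, List.map_nil, List.flatMap_nil, List.nil_append, List.append_nil,
          List.sum_nil, zc]
        rw [if_neg (by omega)]
        linarith
      · have hle : ∀ a b : Tag × ℝ, (p <+: descend a.2 I H ∧ I.1 ≤ a.2 ∧ a.2 < I.2) →
            (p <+: descend b.2 I H ∧ I.1 ≤ b.2 ∧ b.2 < I.2) →
            hfun a b ≤ 2 * ((I.2 - I.1) / 2 ^ p.length) := by
          intro a b ha hb
          have h1 := dist_le H I p a.2 b.2 ha hb
          have := fP_le P2 a b
          have := fP_nonneg (fun t t' => t = t') a b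
          have := le_abs_self (a.2 - b.2)
          simp only [hfun]
          linarith
        have hsub : ∀ b, ∀ a ∈ ((ctTags ht (p ++ [b])).map Sum.inl).flatMap (Blk st),
            p <+: descend a.2 I H ∧ I.1 ≤ a.2 ∧ a.2 < I.2 := fun b a ha =>
          ⟨(List.prefix_append _ _).trans (hmem b a ha).1, (hmem b a ha).2⟩
        rw [cs_append, cs_append]
        have b1 := br_le hfun (((ctTags ht (p ++ [false])).map Sum.inl).flatMap (Blk st))
          (Blk st (.inl p)) _ (by linarith) fun a ha b hb => hle a b (hsub _ a ha) (hM b hb)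
        have b2 := br_le hfun (((ctTags ht (p ++ [false])).map Sum.inl).flatMap (Blk st) ++
          Blk st (.inl p)) (((ctTags ht (p ++ [true])).map Sum.inl).flatMap (Blk st)) _
          (by linarith) fun a ha b hb => hle a b (by
            rw [List.mem_append] at ha
            exact ha.elim (hsub _ a) (hM a)) (hsub _ b hb)
        have ez : zc H I st (.inl p) = 4 * ((I.2 - I.1) / 2 ^ p.length) := by
          simp only [zc]; rw [if_pos ⟨by omega, he⟩]
        rw [ez]
        linarith

theorem cs_nonneg {β : Type} (f : β → β → ℝ) (l : List β) (h : ∀ a b, 0 ≤ f a b) : 0 ≤ cs f l := by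
  induction l with
  | nil => simp [cs]
  | cons a l ih =>
    cases l with
    | nil => simp [cs]
    | cons b l => simp only [cs]; linarith [h a b]

theorem br_nonneg {β : Type} (f : β → β → ℝ) (x y : Option β) (h : ∀ a b, 0 ≤ f a b) :
    0 ≤ br f x y := by
  cases x <;> cases y <;> simp [br, h]

theorem type2 {H α : ℕ} {I : ℝ × ℝ} (hI : I.1 ≤ I.2) {n : ℕ} {s : EnsState} {st : Tag → ETree}
    (h : EInv H α I n s st) :
    cs (fP P2) ((tagsL H α).flatMap (Blk st)) ≤
      9 * (n : ℝ) * H * ((I.2 - I.1) / 2 ^ H) + (I.2 - I.1) := by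
  have t1 := type1 hI h
  have hh := hfun_blks hI h H [] (by simp)
  have hz : (((ctTags H []).map Sum.inl).map (zc H I st)).sum ≤
      8 * (n : ℝ) * H * ((I.2 - I.1) / 2 ^ H) := by
    have e : (((ctTags H []).map Sum.inl).map (zc H I st)).sum = ∑ t ∈ TV H α, zc H I st t := by
      rw [TV, List.sum_toFinset _ (nodup_tagsL H α), tagsL, List.map_append, List.sum_append]
      have : (((List.range α).map Sum.inr).map (zc H I st)).sum = 0 := by
        rw [List.map_map]
        apply List.sum_eq_zero
        intro x hx
        rw [List.mem_map] at hx
        obtain ⟨j, _, rfl⟩ := hx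
        rfl
      rw [this, add_zero]
    rw [e]
    calc ∑ t ∈ TV H α, zc H I st t
        = ∑ m ∈ Finset.range (H - 1), ((∑ t ∈ TV H α, zi st m t : ℕ) : ℝ) *
            (4 * ((I.2 - I.1) / 2 ^ m)) := by
          rw [Finset.sum_congr rfl fun t _ => zc_eq H I st t, Finset.sum_comm]
          apply Finset.sum_congr rfl
          intro m _
          rw [Nat.cast_sum, Finset.sum_mul]
      _ ≤ ∑ m ∈ Finset.range (H - 1), 8 * (n * ((I.2 - I.1) / 2 ^ H)) :=
          Finset.sum_le_sum fun m hm => h.z_real hI m (by rw [Finset.mem_range] at hm; omega)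
      _ = ((H - 1 : ℕ) : ℝ) * (8 * (n * ((I.2 - I.1) / 2 ^ H))) := by simp
      _ ≤ (H : ℝ) * (8 * (n * ((I.2 - I.1) / 2 ^ H))) := by
          apply mul_le_mul_of_nonneg_right
          · exact_mod_cast Nat.sub_le H 1
          · have : 0 ≤ (I.2 - I.1) / 2 ^ H := div_nonneg (by linarith) (by positivity)
            positivity
      _ = _ := by ring
  rw [tagsL, List.flatMap_append, cs_append] at t1 ⊢
  set A := ((ctTags H []).map Sum.inl).flatMap (Blk st) with hAdef
  set B := ((List.range α).map Sum.inr).flatMap (Blk st) with hBdef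
  have hB : ∀ b ∈ B, ∃ j, b.1 = Sum.inr j := by
    intro b hb
    have := (mem_blks hb).1
    rw [List.mem_map] at this
    obtain ⟨j, _, e⟩ := this
    exact ⟨j, e.symm⟩
  have hz0 : ∀ a, ∀ b ∈ B, fP P2 a b ≤ 0 := by
    intro a b hb
    obtain ⟨j, e⟩ := hB b hb
    rw [fP, if_neg]
    rintro ⟨_, _, p, hp⟩
    rw [e] at hp; simp at hp
  have c1 := cs_nonpos (fP P2) B fun a _ b hb => hz0 a b hb
  have c2 := br_le (fP P2) A B 0 le_rfl fun a _ b hb => hz0 a b hb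
  have c3 := cs_nonneg (fP (fun t t' => t = t')) B (fP_nonneg _)
  have c4 := br_nonneg (fP (fun t t' => t = t')) A.getLast? B.head? (fP_nonneg _)
  have c5 : cs (fP P2) A = cs hfun A + cs (fP (fun t t' => t = t')) A +
      cs (fun a b => b.2 - a.2) A := by
    rw [← cs_add, ← cs_add]
    apply cs_congr
    intro a _ b _
    simp only [hfun]; ring
  have hA : ∀ a ∈ A, I.1 ≤ a.2 ∧ a.2 < I.2 := by
    intro a ha
    obtain ⟨k1, k2⟩ := mem_blks ha
    have : TVal H α a.1 := by rw [← mem_tagsL, tagsL, List.mem_append]; exact Or.inl k1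
    exact ((h.wf _ this).elems_ext _ k2).2
  have c6 := cs_tele (fun a : Tag × ℝ => a.2) A (I.2 - I.1) (by linarith) (by
    intro a ha b hb
    linarith [(hA a ha).1, (hA a ha).2, (hA b hb).1, (hA b hb).2])
  linarith

theorem occ_zero (α : ℕ) (I : ℝ × ℝ) (xs : List ℝ) : occSeq 0 α (ensRun 0 α I xs).2 = [] := by
  have hB : ∀ (l : List ℕ) (x : ℝ) (B : ℕ → ETState), (∀ j, (B j).label [] ≠ none) →
      tryBs 0 x l B = (false, B) := by
    intro l x
    induction l with
    | nil => intro B _; rfl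
    | cons j l ih =>
      intro B hB
      have e : etInsertTop 0 x (B j) = (false, B j) := by
        rw [etInsertTop, etInsert]
        cases hj : (B j).label [] with
        | none => exact absurd hj (hB j)
        | some J => rfl
      rw [tryBs, e]
      have : (fun i => if i = j then B j else B i) = B := by
        funext i; split_ifs with hi
        · rw [hi]
        · rfl
      simp only [this]
      exact ih B hB
  have hins : ∀ (x : ℝ) (s : EnsState), (∀ j, (s.B j).label [] ≠ none) →
      (ensInsert 0 α I x s).2 = s := by
    intro x s hs
    simp [ensInsert, ctInsert, ctNodeSeq, tryNodes, hB _ x _ hs]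
  have key : ∀ (xs : List ℝ) (acc : Bool × EnsState), (∀ j, (acc.2.B j).label [] ≠ none) →
      (xs.foldl (fun acc x =>
        let r := ensInsert 0 α I x acc.2
        (acc.1 && r.1, r.2)) acc).2 = acc.2 := by
    intro xs
    induction xs with
    | nil => intro acc _; rfl
    | cons x xs ih =>
      intro acc hacc
      rw [List.foldl_cons, ih _ (by simp only [hins x acc.2 hacc]; exact hacc)]
      exact hins x acc.2 hacc
  have e : (ensRun 0 α I xs).2 = ensInit I := key xs _ (by intro j; simp [ensInit, ETState.init])
  rw [e, occSeq, List.filterMap_eq_nil_iff]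
  intro c hc
  simp only [ensCells, ctCellsAux, List.map_nil, List.nil_append, List.mem_flatMap, List.mem_map] at hc
  obtain ⟨j, _, i, _, rfl⟩ := hc
  simp [ensInit, ETState.init]

/-!
STATEMENT 18 (Cost Lemma): suppose the `n` elements of `xs` are inserted into a tree
ensemble `A, B 0, …, B (α-1)` of height `H` whose common root label `I₀` has length `ℓ`.
For elements occupying consecutive non-empty cells of the ensemble's array, the cost
`|x - y|` is Type 1 if both lie in the same elementary tree, Type 2 if they lie in
elementary trees representing two different nodes of `A`, and Type 3 if `x` lies in `A`
and `y` in `B 0`, or `x` lies in `B j` and `y` in `B (j+1)`.  Then the total Type 1 cost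
is at most `n H (ℓ / 2^H)`, the total Type 2 cost is at most `9 n H (ℓ / 2^H) + ℓ`, and
the total Type 3 cost is at most `α ℓ`.
-/
theorem statement18 (H α : ℕ) (I₀ : ℝ × ℝ) (hI₀ : I₀.1 < I₀.2)
    (xs : List ℝ) (hxs : ∀ x ∈ xs, x ∈ Set.Ico I₀.1 I₀.2) :
    pairSum (fun t t' => t = t') (consecPairs H α (ensRun H α I₀ xs).2) ≤
      (xs.length : ℝ) * H * ((I₀.2 - I₀.1) / 2 ^ H) ∧
    pairSum (fun t t' => t ≠ t' ∧ (∃ p, t = Sum.inl p) ∧ ∃ p', t' = Sum.inl p')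
        (consecPairs H α (ensRun H α I₀ xs).2) ≤
      9 * (xs.length : ℝ) * H * ((I₀.2 - I₀.1) / 2 ^ H) + (I₀.2 - I₀.1) ∧
    pairSum (fun t t' => ((∃ p, t = Sum.inl p) ∧ t' = Sum.inr 0) ∨
        ∃ j : ℕ, t = Sum.inr j ∧ t' = Sum.inr (j + 1))
        (consecPairs H α (ensRun H α I₀ xs).2) ≤
      (α : ℝ) * (I₀.2 - I₀.1) := by
  have hI : I₀.1 ≤ I₀.2 := hI₀.le
  have hl : 0 ≤ I₀.2 - I₀.1 := by linarith
  rw [pairSum_eq, pairSum_eq, pairSum_eq]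
  rcases Nat.eq_zero_or_pos H with rfl | hH
  · rw [occ_zero]
    simp only [cs]
    refine ⟨by simp, by simpa using hI, by positivity⟩
  · obtain ⟨st, h⟩ := EInv.run (α := α) hH hI xs hxs
    rw [occSeq_eq h]
    refine ⟨type1 hI h, type2 hI h, type3 hI h _ ?_⟩
    rintro t t' (⟨⟨p, rfl⟩, rfl⟩ | ⟨j, rfl, rfl⟩)
    · exact ⟨by simp, 0, rfl⟩
    · exact ⟨by simp, j + 1, rfl⟩
end
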